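/- arXiv:0810.4060 — 3 statements merged into one kernel-verified Lean document; each statement's English description precedes it below -/
import Mathlib

section
/- Let ⟨X | R⟩ be a finite presentation and let L = max{‖r‖ : r ∈ R} (with ‖·‖ denoting reduced word length in the free group F(X)). Let w ∈ F(X) be null-homotopic with Area(w) = N. Then there exist u_1, …, u_N ∈ F(X) and r_1, …, r_N ∈ R ∪ R^{-1} such that w = ∏_{i=1}^N u_i r_i u_i^{-1} in F(X) and ‖u_1‖ + ∑_{i=1}^{N-1} ‖u_i^{-1} u_{i+1}‖ + ‖u_N‖ ≤ ‖w‖ + 2LN. -/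
open Subgroup

/-- Reduced word length in a free group. -/
noncomputable def fgNorm {X : Type*} (w : FreeGroup X) : ℕ :=
  @FreeGroup.norm X (Classical.decEq X) w

/-- `w` is a product of exactly `N` conjugates of elements of `R ∪ R⁻¹`. -/
def ExprOf {X : Type*} (R : Set (FreeGroup X)) (w : FreeGroup X) (N : ℕ) : Prop :=
  ∃ l : List (FreeGroup X × FreeGroup X),
    l.length = N ∧ (∀ p ∈ l, p.2 ∈ R ∨ p.2⁻¹ ∈ R) ∧
    (l.map fun p => p.1 * p.2 * p.1⁻¹).prod = w

/-- The area of a null-homotopic word: the least number of conjugates of relators needed. -/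
noncomputable def area {X : Type*} (R : Set (FreeGroup X)) (w : FreeGroup X) : ℕ :=
  sInf {N | ExprOf R w N}

/-- The Dehn function of the presentation with relator set `R`. -/
noncomputable def dehn {X : Type*} (R : Set (FreeGroup X)) (l : ℕ) : ℕ :=
  sSup {A | ∃ w ∈ Subgroup.normalClosure R, fgNorm w ≤ l ∧ A = area R w}

/-- `f ⪯ g`. -/
def Preceq (f g : ℕ → ℕ) : Prop := ∃ C : ℕ, ∀ l, f l ≤ C * g (C * l + C) + C * l + C

/-- `f ≃ g`. -/
def FEquiv (f g : ℕ → ℕ) : Prop := Preceq f g ∧ Preceq g f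

/-- `φ` realizes `⟨X | R⟩` as a presentation of `G`. -/
def Presents {X : Type*} {G : Type*} [Group G] (R : Set (FreeGroup X))
    (φ : FreeGroup X →* G) : Prop :=
  Function.Surjective φ ∧ φ.ker = Subgroup.normalClosure R

def FinitelyPresentedGroup (G : Type*) [Group G] : Prop :=
  ∃ (X : Type) (_ : Finite X) (R : Set (FreeGroup X)) (φ : FreeGroup X →* G),
    R.Finite ∧ Presents R φ

/-- `f` is an isoperimetric function for `G` : the Dehn function of every finite
presentation of `G` is `⪯ f`. -/
def IsIsopFunction (G : Type*) [Group G] (f : ℕ → ℕ) : Prop :=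
  ∀ (X : Type) (R : Set (FreeGroup X)) (φ : FreeGroup X →* G),
    Finite X → R.Finite → Presents R φ → Preceq (dehn R) f

/-- `(α, ρ)` is an area-radius pair for the presentation with relator set `R`. -/
def IsAreaRadiusPair {X : Type*} (R : Set (FreeGroup X)) (α ρ : ℕ → ℕ) : Prop :=
  ∀ w ∈ Subgroup.normalClosure R, ∀ l : ℕ, fgNorm w ≤ l →
    ∃ L : List (FreeGroup X × FreeGroup X), L.length ≤ α l ∧
      (∀ p ∈ L, (p.2 ∈ R ∨ p.2⁻¹ ∈ R) ∧ fgNorm p.1 ≤ ρ l) ∧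
      (L.map fun p => p.1 * p.2 * p.1⁻¹).prod = w

/-- `g` is a product of at most `k` elements of `S ∪ S⁻¹`. -/
def WordLe {G : Type*} [Group G] (S : Set G) (g : G) (k : ℕ) : Prop :=
  ∃ l : List G, l.length ≤ k ∧ (∀ x ∈ l, x ∈ S ∨ x⁻¹ ∈ S) ∧ l.prod = g

/-- Word length of `g` with respect to the generating set `S`. -/
noncomputable def wordLength {G : Type*} [Group G] (S : Set G) (g : G) : ℕ :=
  sInf {k | WordLe S g k}

namespace FreeGroup

variable {α : Type*}

lemma mk_cons_eq (x : α × Bool) (l : List (α × Bool)) : mk (x :: l) = mk [x] * mk l := by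
  rw [mul_mk]; rfl

lemma mk_append_eq (l m : List (α × Bool)) : mk (l ++ m) = mk l * mk m := mul_mk.symm

@[simp] lemma mk_nil_eq : mk ([] : List (α × Bool)) = 1 := rfl

lemma mk_invRev (l : List (α × Bool)) : mk (invRev l) = (mk l)⁻¹ := inv_mk.symm

lemma mk_singleton_not (x : α × Bool) : mk [(x.1, !x.2)] = (mk [x])⁻¹ := by
  rw [inv_mk]; rfl

section Reduce

variable [DecidableEq α]

/-- A letter of the reduced form of an unreduced word `l` is inherited from a letter of `l`. -/
lemma exists_split_of_reduce_eq {l p q : List (α × Bool)} {y : α × Bool}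
    (h : reduce l = p ++ y :: q) :
    ∃ a b, l = a ++ y :: b ∧ mk a = mk p ∧ mk b = mk q := by
  induction l generalizing p q with
  | nil => simp at h
  | cons z l ih =>
    rw [reduce.cons] at h
    rcases hl : reduce l with _ | ⟨u, t⟩
    · rw [hl] at h
      obtain ⟨rfl, rfl, rfl⟩ : p = [] ∧ y = z ∧ q = [] := by
        rcases p with _ | ⟨_, _⟩ <;> simp_all
      exact ⟨[], l, rfl, rfl, by rw [← reduce.self (L := l), hl]⟩
    · rw [hl] at h
      dsimp only at h
      split_ifs at h with hc
      · have hu : u = (z.1, !z.2) := by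
          ext <;> simp [hc.1, hc.2]
        obtain ⟨a, b, rfl, ha, hb⟩ := ih (p := u :: p) (q := q) (by rw [hl, h]; rfl)
        refine ⟨z :: a, b, rfl, ?_, hb⟩
        rw [mk_cons_eq, ha, mk_cons_eq u, hu, mk_singleton_not, mul_inv_cancel_left]
      · rcases p with _ | ⟨v, p⟩
        · obtain ⟨rfl, rfl⟩ : z = y ∧ u :: t = q := by simpa using h
          exact ⟨[], l, rfl, rfl, by rw [← hl, reduce.self]⟩
        · obtain ⟨rfl, h'⟩ : z = v ∧ u :: t = p ++ y :: q := by simpa using h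
          obtain ⟨a, b, rfl, ha, hb⟩ := ih (hl.trans h')
          exact ⟨z :: a, b, rfl, by rw [mk_cons_eq, ha, ← mk_cons_eq], hb⟩

/-- In a product `p * y * q` with `y` a letter, either `y` cancels against the end of `p` or the
start of `q`, or the product is reduced as written. -/
lemma cancel_or_norm_eq (p q : FreeGroup α) (y : α × Bool) :
    (∃ t, p.toWord = t ++ [(y.1, !y.2)]) ∨ (∃ t, q.toWord = (y.1, !y.2) :: t) ∨
      norm (p * mk [y] * q) = norm p + 1 + norm q := by
  by_cases h₁ : ∃ t, p.toWord = t ++ [(y.1, !y.2)]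
  · exact .inl h₁
  by_cases h₂ : ∃ t, q.toWord = (y.1, !y.2) :: t
  · exact .inr (.inl h₂)
  refine .inr (.inr ?_)
  have hred : IsReduced (p.toWord ++ y :: q.toWord) := by
    have hp : IsReduced p.toWord := isReduced_toWord
    have hq : IsReduced q.toWord := isReduced_toWord
    rw [IsReduced] at *
    refine List.isChain_append.2 ⟨hp, List.isChain_cons.2 ⟨?_, hq⟩, ?_⟩
    · intro z hz hyz
      by_contra hne
      obtain ⟨t, ht⟩ := List.head?_eq_some_iff.1 hz
      exact h₂ ⟨t, by
        rw [ht, show z = (y.1, !y.2) from Prod.ext hyz.symm (Bool.eq_not.2 (Ne.symm hne))]⟩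
    · intro z hz v hv hyz
      obtain rfl : y = v := by simpa using hv
      by_contra hne
      obtain ⟨t, ht⟩ := List.getLast?_eq_some_iff.1 hz
      exact h₁ ⟨t, by
        rw [ht, show z = (y.1, !y.2) from Prod.ext hyz (Bool.eq_not.2 hne)]⟩
  have : p * mk [y] * q = mk (p.toWord ++ y :: q.toWord) := by
    rw [mk_append_eq, mk_cons_eq y q.toWord, mk_toWord, mk_toWord, mul_assoc]
  rw [this, norm, toWord_mk, hred.reduce_eq]
  simp [norm]
  omega

end Reduce

/-- A letter of the alphabet, or a marker carrying an element of `S`. A list of such items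
encodes a product of conjugates of elements of `S`, provided that the letters alone multiply to
`1`. -/
abbrev MarkedLetter {α : Type*} (S : Set (FreeGroup α)) := (α × Bool) ⊕ S

namespace MarkedLetter

variable {S : Set (FreeGroup α)}

/-- The word spelled by an item in which markers count as the empty word. -/
def bare (i : MarkedLetter S) : List (α × Bool) := Sum.elim (fun y => [y]) (fun _ => []) i

/-- The element spelled by a list of items, when each item spells a word. -/
def eval (e : MarkedLetter S → List (α × Bool)) (V : List (MarkedLetter S)) : FreeGroup α :=
  mk (V.flatMap e)

/-- The number of markers. -/
def markers (V : List (MarkedLetter S)) : ℕ := V.countP Sum.isRight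

/-- The number of letters. -/
def letters (V : List (MarkedLetter S)) : ℕ := V.countP Sum.isLeft

/-- A word without markers. -/
def ofWord (l : List (α × Bool)) : List (MarkedLetter S) := l.map Sum.inl

section Basic

variable (e : MarkedLetter S → List (α × Bool)) (U V : List (MarkedLetter S))
  (x : α × Bool) (r : S) (l : List (α × Bool))

@[simp] lemma eval_nil : eval e [] = 1 := rfl

@[simp] lemma eval_append : eval e (U ++ V) = eval e U * eval e V := by
  simp [eval]

lemma eval_cons (i : MarkedLetter S) : eval e (i :: V) = mk (e i) * eval e V := by
  simp [eval]

@[simp] lemma eval_bare_inl : eval bare (.inl x :: V) = mk [x] * eval bare V := eval_cons _ _ _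

@[simp] lemma eval_bare_inr : eval bare (.inr r :: V) = eval bare V := by
  rw [eval_cons]; exact one_mul _

@[simp] lemma eval_bare_ofWord : eval bare (ofWord l : List (MarkedLetter S)) = mk l := by
  simp [eval, ofWord, List.flatMap_map, bare]

@[simp] lemma markers_nil : markers ([] : List (MarkedLetter S)) = 0 := rfl
@[simp] lemma markers_append : markers (U ++ V) = markers U + markers V := List.countP_append
@[simp] lemma markers_inl : markers (.inl x :: V) = markers V := by simp [markers]
@[simp] lemma markers_inr : markers (.inr r :: V) = markers V + 1 :=
  List.countP_cons_of_pos rfl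
@[simp] lemma markers_ofWord : markers (ofWord l : List (MarkedLetter S)) = 0 := by
  simp [markers, ofWord]

@[simp] lemma letters_nil : letters ([] : List (MarkedLetter S)) = 0 := rfl
@[simp] lemma letters_append : letters (U ++ V) = letters U + letters V := List.countP_append
@[simp] lemma letters_inl : letters (.inl x :: V) = letters V + 1 :=
  List.countP_cons_of_pos rfl
@[simp] lemma letters_inr : letters (.inr r :: V) = letters V := by simp [letters]
@[simp] lemma letters_ofWord : letters (ofWord l : List (MarkedLetter S)) = l.length := by
  simp [letters, ofWord, Function.comp_def]

end Basic

/-- The conjugators and conjugated elements encoded by a list of items, read after the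
prefix `p`. -/
def conjugates : FreeGroup α → List (MarkedLetter S) → List (FreeGroup α × FreeGroup α)
  | _, [] => []
  | p, .inl y :: V => conjugates (p * mk [y]) V
  | p, .inr r :: V => (p, r.1) :: conjugates p V

lemma length_conjugates (p : FreeGroup α) (V : List (MarkedLetter S)) :
    (conjugates p V).length = markers V := by
  induction V generalizing p with
  | nil => rfl
  | cons i V ih => rcases i with y | r <;> simp [conjugates, ih]

lemma mem_of_mem_conjugates {p : FreeGroup α} {V : List (MarkedLetter S)}
    {c : FreeGroup α × FreeGroup α} (h : c ∈ conjugates p V) : c.2 ∈ S := by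
  induction V generalizing p with
  | nil => simp [conjugates] at h
  | cons i V ih =>
    rcases i with y | r
    · exact ih h
    · rcases List.mem_cons.1 h with rfl | h
      · exact r.2
      · exact ih h

variable [DecidableEq α]

/-- The word spelled by an item in which a marker counts as the element it carries. -/
def full (i : MarkedLetter S) : List (α × Bool) := Sum.elim (fun y => [y]) (fun r => r.1.toWord) i

@[simp] lemma eval_full_inl (x : α × Bool) (V : List (MarkedLetter S)) :
    eval full (.inl x :: V) = mk [x] * eval full V := eval_cons _ _ _

@[simp] lemma eval_full_inr (r : S) (V : List (MarkedLetter S)) :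
    eval full (.inr r :: V) = r.1 * eval full V := by
  rw [eval_cons]; simp [full, mk_toWord]

@[simp] lemma eval_full_ofWord (l : List (α × Bool)) :
    eval full (ofWord l : List (MarkedLetter S)) = mk l := by
  simp [eval, ofWord, List.flatMap_map, full]

/-- A letter of the reduced form of `eval e V` is inherited from an item of `V`. -/
lemma exists_split (e : MarkedLetter S → List (α × Bool)) {V : List (MarkedLetter S)}
    {p q : List (α × Bool)} {y : α × Bool} (h : (eval e V).toWord = p ++ y :: q) :
    ∃ A i B f g, V = A ++ i :: B ∧ e i = f ++ y :: g ∧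
      eval e A * mk f = mk p ∧ mk g * eval e B = mk q := by
  obtain ⟨a, b, hab, ha, hb⟩ := exists_split_of_reduce_eq h
  rw [← ha, ← hb]
  clear h ha hb
  induction V generalizing a with
  | nil => simp at hab
  | cons i V ih =>
    rw [List.flatMap_cons, List.append_eq_append_iff] at hab
    rcases hab with ⟨c, rfl, hc⟩ | ⟨c, hc, hb⟩
    · obtain ⟨A, j, B, f, g, rfl, hj, h₁, h₂⟩ := ih c hc
      refine ⟨i :: A, j, B, f, g, rfl, hj, ?_, h₂⟩
      rw [eval_cons, mul_assoc, h₁, mk_append_eq]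
    · rcases c with _ | ⟨z, c⟩
      · obtain ⟨A, j, B, f, g, rfl, hj, h₁, h₂⟩ := ih [] (by simpa using hb.symm)
        refine ⟨i :: A, j, B, f, g, rfl, hj, ?_, h₂⟩
        rw [eval_cons, mul_assoc, h₁, hc, mk_append_eq]
        simp
      · obtain ⟨rfl, rfl⟩ : y = z ∧ b = c ++ V.flatMap e := by simpa using hb
        exact ⟨[], i, V, a, c, rfl, hc, by simp, by simp [eval]⟩

/-- `w` is a product of at most `n` conjugates of elements of `S`, with noise at most the length
of `w` plus `2 * L` for each conjugate. -/
def HasThin (S : Set (FreeGroup α)) (L : ℕ) (w : FreeGroup α) (n : ℕ) : Prop :=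
  ∃ V : List (MarkedLetter S), eval full V = w ∧ eval bare V = 1 ∧ markers V ≤ n ∧
    letters V ≤ norm w + 2 * L * markers V

lemma HasThin.mono {L m n : ℕ} {w : FreeGroup α} (h : HasThin S L w m) (hmn : m ≤ n) :
    HasThin S L w n := by
  obtain ⟨V, h₁, h₂, h₃, h₄⟩ := h
  exact ⟨V, h₁, h₂, h₃.trans hmn, h₄⟩

/-- A first letter lying on a relator may be pushed across that relator. -/
lemma HasThin.of_push {L m : ℕ} {x : α × Bool} {b : FreeGroup α} {r : S}
    {f g : List (α × Bool)} (hr : r.1.toWord = f ++ x :: g) (hL : norm r.1 ≤ L)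
    (hn : norm (mk [x] * b) = norm b + 1)
    (h : HasThin S L ((mk f)⁻¹ * (mk g)⁻¹ * b) m) : HasThin S L (mk [x] * b) (m + 1) := by
  obtain ⟨V, h₁, h₂, h₃, h₄⟩ := h
  have hr' : r.1 = mk f * (mk [x] * mk g) := by
    rw [← mk_toWord (x := r.1), hr, mk_append_eq, mk_cons_eq]
  have hlen : norm r.1 = f.length + (g.length + 1) := by rw [norm, hr]; simp
  have hle : norm ((mk f)⁻¹ * (mk g)⁻¹ * b) ≤ f.length + g.length + norm b := by
    refine (norm_mul_le _ _).trans (Nat.add_le_add_right ((norm_mul_le _ _).trans ?_) _)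
    rw [norm_inv_eq, norm_inv_eq]
    exact Nat.add_le_add norm_mk_le norm_mk_le
  have hL' : 2 * L * (markers V + 1) = 2 * L * markers V + 2 * L := by ring
  by_cases hfg : f.length ≤ g.length + 1
  · refine ⟨ofWord (invRev f) ++ .inr r :: (ofWord f ++ V), ?_, ?_, ?_, ?_⟩
    · simp only [eval_append, eval_full_ofWord, eval_full_inr, mk_invRev, h₁, hr']
      group
    · simp [-mul_mk, -inv_mk, mk_invRev, h₂]
    · simpa using h₃
    · simp [hn]
      omega
  · refine ⟨.inl x :: (ofWord g ++ .inr r :: (ofWord (invRev (x :: g)) ++ V)), ?_, ?_, ?_, ?_⟩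
    · simp only [eval_append, eval_full_ofWord, eval_full_inr, eval_full_inl, mk_invRev, h₁, hr',
        mk_cons_eq x g]
      group
    · simp only [eval_append, eval_bare_ofWord, eval_bare_inr, eval_bare_inl, mk_invRev, h₂,
        mk_cons_eq x g]
      group
    · simpa using h₃
    · simp [hn]
      omega

/-- The item carrying a letter is either that very letter or a marker. -/
lemma full_eq_append {i : MarkedLetter S} {f g : List (α × Bool)} {y : α × Bool}
    (h : full i = f ++ y :: g) :
    (i = .inl y ∧ f = [] ∧ g = []) ∨ ∃ r : S, i = .inr r ∧ r.1.toWord = f ++ y :: g := by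
  rcases i with z | r
  · left
    rcases f with _ | ⟨u, f⟩ <;> simp_all [full]
  · exact .inr ⟨r, rfl, h⟩

/-- Every letter of a list whose letters multiply to `1` has a partner. -/
lemma exists_partner {x : α × Bool} {C : List (MarkedLetter S)}
    (h : mk [x] * eval bare C = 1) :
    ∃ s D, C = s ++ .inl (x.1, !x.2) :: D ∧ eval bare s = 1 ∧ eval bare D = 1 := by
  have hw : (eval bare C).toWord = [] ++ (x.1, !x.2) :: [] := by
    rw [eq_inv_of_mul_eq_one_right h, ← mk_singleton_not, toWord_mk]; rfl
  obtain ⟨s, i, D, f, g, rfl, hi, h₁, h₂⟩ := exists_split bare hw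
  rcases i with z | r
  · obtain ⟨rfl, rfl, rfl⟩ : f = [] ∧ z = (x.1, !x.2) ∧ g = [] := by
      rcases f with _ | ⟨u, f⟩ <;> simp_all [bare]
    exact ⟨s, D, rfl, by simpa using h₁, by simpa using h₂⟩
  · simp [bare] at hi

/-- Induction step for `hasThin_eval_full`: simplify `V` at the first letter of the element it
spells. -/
lemma hasThin_of_forall_smaller {L : ℕ} (hL : ∀ r ∈ S, norm r ≤ L) {V : List (MarkedLetter S)}
    (hV : eval bare V = 1)
    (ih : ∀ U : List (MarkedLetter S), eval bare U = 1 →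
      (markers U < markers V ∨ markers U ≤ markers V ∧ U.length < V.length) →
      HasThin S L (eval full U) (markers U)) :
    HasThin S L (eval full V) (markers V) := by
  by_cases hw : eval full V = 1
  · rw [hw]
    exact ⟨[], rfl, rfl, Nat.zero_le _, Nat.zero_le _⟩
  obtain ⟨x, t, ht⟩ := List.exists_cons_of_ne_nil (mt toWord_eq_nil_iff.1 hw)
  have hnorm : norm (eval full V) = norm (mk t) + 1 := by
    have : IsReduced t := (ht ▸ isReduced_toWord (x := eval full V)).infix ⟨[x], [], by simp⟩
    rw [norm, norm, ht, toWord_mk, this.reduce_eq]; rfl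
  have hwt : eval full V = mk [x] * mk t := by
    rw [← mk_cons_eq, ← ht, mk_toWord]
  rw [hwt] at hnorm ⊢
  obtain ⟨A, i, B, f, g, rfl, hi, h₁, h₂⟩ := exists_split full (p := []) ht
  have hA : eval full A = (mk f)⁻¹ := eq_inv_of_mul_eq_one_left h₁
  rcases full_eq_append hi with ⟨rfl, rfl, rfl⟩ | ⟨r, rfl, hr⟩
  swap
  · have ih := ih (A ++ B) (by simpa using hV) (by simp)
    refine (HasThin.of_push hr (hL _ r.2) hnorm (m := markers (A ++ B)) ?_).mono ?_
    · convert ih using 1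
      simp [-mul_mk, -inv_mk, hA, ← h₂, mul_assoc]
    · simp
  obtain ⟨s, D, hBA, hs, hD⟩ := exists_partner (x := x) (C := B ++ A) (by
    have hV' : eval bare A * (mk [x] * eval bare B) = 1 := by simpa using hV
    rw [eval_append, ← mul_assoc, eq_inv_of_mul_eq_one_left hV', mul_inv_cancel])
  have ht' : mk t = eval full s * (mk [x])⁻¹ * eval full D := by
    have h : eval full (B ++ A) = mk t := by
      have hB : eval full B = mk t := by simpa using h₂
      have hA' : eval full A = 1 := by simpa using hA
      rw [eval_append, hB, hA', mul_one]
    rw [← h, hBA]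
    simp [-mul_mk, -inv_mk, mk_singleton_not, mul_assoc]
  have hM : markers (A ++ .inl x :: B) = markers s + markers D := by
    have := congrArg markers hBA
    simp at this ⊢
    omega
  have hlen : (A ++ .inl x :: B).length = s.length + D.length + 2 := by
    have := congrArg List.length hBA
    simp at this ⊢
    omega
  rw [hM, hlen] at ih
  rw [hM]
  have hcase := cancel_or_norm_eq (eval full s) (eval full D) (x.1, !x.2)
  rw [mk_singleton_not, ← ht'] at hcase
  simp only [Bool.not_not, Prod.mk.eta] at hcase
  rcases hcase with ⟨l, hl⟩ | ⟨l, hl⟩ | hadd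
  · obtain ⟨S₁, j, S₂, f, g, rfl, hj, -, h₄⟩ := exists_split full hl
    have hS₂ : eval full S₂ = (mk g)⁻¹ := eq_inv_of_mul_eq_one_right h₄
    rcases full_eq_append hj with ⟨rfl, rfl, rfl⟩ | ⟨r, rfl, hr⟩
    · have ih := ih (.inl x :: (S₂ ++ S₁ ++ D)) (by
        have h : eval bare S₁ * (mk [x] * eval bare S₂) = 1 := by simpa using hs
        simp only [eval_bare_inl, eval_append, hD, mul_one]
        rw [← mul_assoc, eq_inv_of_mul_eq_one_left h, mul_inv_cancel]) (by simp; omega)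
      have hS₂' : eval full S₂ = 1 := by simpa using hS₂
      have he : mk [x] * mk t = eval full (.inl x :: (S₂ ++ S₁ ++ D)) := by
        rw [ht']; simp [-mul_mk, -inv_mk, hS₂', mul_assoc]
      rw [he]
      exact ih.mono (by simp; omega)
    · have ih := ih (ofWord (invRev f) ++ S₂ ++ S₁ ++ ofWord f ++ D) (by
        have h : eval bare S₁ * eval bare S₂ = 1 := by simpa using hs
        simp [-mul_mk, -inv_mk, mk_invRev, hD, eq_inv_of_mul_eq_one_left h]) (by simp; omega)
      refine (HasThin.of_push hr (hL _ r.2) hnorm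
        (m := markers (ofWord (invRev f) ++ S₂ ++ S₁ ++ ofWord f ++ D)) ?_).mono ?_
      · convert ih using 1
        have hr' : r.1 = mk f * (mk [x] * mk g) := by
          rw [← mk_toWord (x := r.1), hr, mk_append_eq, mk_cons_eq]
        simp [-mul_mk, -inv_mk, mk_invRev, ht', hS₂, hr', mul_assoc]
      · simp; omega
  · obtain ⟨D₁, j, D₂, f, g, rfl, hj, h₃, -⟩ := exists_split full (p := []) hl
    have hD₁ : eval full D₁ = (mk f)⁻¹ := eq_inv_of_mul_eq_one_left h₃
    rcases full_eq_append hj with ⟨rfl, rfl, rfl⟩ | ⟨r, rfl, hr⟩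
    · have ih := ih (.inl x :: (s ++ D₂ ++ D₁)) (by
        have h : eval bare D₁ * (mk [x] * eval bare D₂) = 1 := by simpa using hD
        simp only [eval_bare_inl, eval_append, hs, one_mul]
        rw [← mul_assoc, eq_inv_of_mul_eq_one_left h, mul_inv_cancel]) (by simp; omega)
      have hD₁' : eval full D₁ = 1 := by simpa using hD₁
      have he : mk [x] * mk t = eval full (.inl x :: (s ++ D₂ ++ D₁)) := by
        rw [ht']; simp [-mul_mk, -inv_mk, hD₁', mul_assoc]
      rw [he]
      exact ih.mono (by simp; omega)
    · have ih := ih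
        (ofWord (invRev f) ++ ofWord (invRev g) ++ s ++ ofWord g ++ ofWord f ++ D₁ ++ D₂) (by
        have h : eval bare D₁ * eval bare D₂ = 1 := by simpa using hD
        simp [-mul_mk, -inv_mk, mk_invRev, hs, h]) (by simp)
      refine (HasThin.of_push hr (hL _ r.2) hnorm (m := markers
        (ofWord (invRev f) ++ ofWord (invRev g) ++ s ++ ofWord g ++ ofWord f ++ D₁ ++ D₂))
        ?_).mono ?_
      · convert ih using 1
        have hr' : r.1 = mk f * (mk [x] * mk g) := by
          rw [← mk_toWord (x := r.1), hr, mk_append_eq, mk_cons_eq]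
        simp [-mul_mk, -inv_mk, mk_invRev, ht', hD₁, hr', mul_assoc]
      · simp
  · obtain ⟨V₁, a₁, b₁, c₁, d₁⟩ := ih s hs (by omega)
    obtain ⟨V₂, a₂, b₂, c₂, d₂⟩ := ih D hD (by omega)
    refine ⟨.inl x :: (V₁ ++ .inl (x.1, !x.2) :: V₂), ?_, ?_, ?_, ?_⟩
    · simp [-mul_mk, -inv_mk, a₁, a₂, ht', mk_singleton_not, mul_assoc]
    · simp [-mul_mk, -inv_mk, b₁, b₂, mk_singleton_not]
    · simp; omega
    · simp [-mul_mk, hnorm, hadd, mul_add]; omega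

/-- Every product of conjugates of elements of `S` can be rewritten with little noise, without
using more conjugates. -/
theorem hasThin_eval_full {L : ℕ} (hL : ∀ r ∈ S, norm r ≤ L) (V : List (MarkedLetter S))
    (hV : eval bare V = 1) : HasThin S L (eval full V) (markers V) :=
  hasThin_of_forall_smaller hL hV fun U hU _ => hasThin_eval_full hL U hU
termination_by (markers V, V.length)
decreasing_by
  rw [Prod.lex_def]
  omega

lemma prod_conjugates (p : FreeGroup α) (V : List (MarkedLetter S)) :
    ((conjugates p V).map fun c => c.1 * c.2 * c.1⁻¹).prod =
      p * eval full V * (p * eval bare V)⁻¹ := by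
  induction V generalizing p with
  | nil => simp [conjugates]
  | cons i V ih => rcases i with y | r <;> simp only [conjugates, List.map_cons, List.prod_cons, ih,
      eval_full_inl, eval_bare_inl, eval_full_inr, eval_bare_inr] <;> group

/-- The total length of the steps from `q` through the conjugators in the list to `z`. -/
def noise (z : FreeGroup α) : FreeGroup α → List (FreeGroup α × FreeGroup α) → ℕ
  | q, [] => norm (q⁻¹ * z)
  | q, c :: l => norm (q⁻¹ * c.1) + noise z c.1 l

lemma noise_conjugates_le (q p : FreeGroup α) (V : List (MarkedLetter S)) :
    noise (p * eval bare V) q (conjugates p V) ≤ norm (q⁻¹ * p) + letters V := by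
  induction V generalizing q p with
  | nil => simp [conjugates, noise]
  | cons i V ih =>
    rcases i with y | r
    · have h := ih q (p * mk [y])
      have h' : norm (q⁻¹ * p * mk [y]) ≤ norm (q⁻¹ * p) + 1 :=
        (norm_mul_le _ _).trans (Nat.add_le_add_left norm_mk_le _)
      simp only [mul_assoc] at h h'
      simp only [conjugates, eval_bare_inl, letters_inl]
      omega
    · have h := ih p p
      simp only [inv_mul_cancel, norm_one] at h
      simp only [conjugates, noise, eval_bare_inr, letters_inr]
      omega

lemma noise_cons_eq (z q : FreeGroup α) (c : FreeGroup α × FreeGroup α)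
    (l : List (FreeGroup α × FreeGroup α)) :
    noise z q (c :: l) = norm (q⁻¹ * c.1) +
      ((List.range l.length).map fun i => norm
        (((c :: l).getD i (1, 1)).1⁻¹ * ((c :: l).getD (i + 1) (1, 1)).1)).sum +
      norm ((((c :: l).getD l.length (1, 1)).1)⁻¹ * z) := by
  induction l generalizing q c with
  | nil => simp [noise]
  | cons d l ih =>
    rw [noise, ih, List.length_cons, List.range_succ_eq_map]
    simp [Function.comp_def, add_assoc]

/-- Every product of conjugates of elements of `S` is encoded by a list of items. -/
lemma exists_eval_eq_prod (l : List (FreeGroup α × FreeGroup α)) (hl : ∀ c ∈ l, c.2 ∈ S) :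
    ∃ V : List (MarkedLetter S), eval full V = (l.map fun c => c.1 * c.2 * c.1⁻¹).prod ∧
      eval bare V = 1 ∧ markers V = l.length := by
  induction l with
  | nil => exact ⟨[], rfl, rfl, rfl⟩
  | cons c l ih =>
    obtain ⟨V, h₁, h₂, h₃⟩ := ih fun d hd => hl d (List.mem_cons_of_mem _ hd)
    refine ⟨ofWord c.1.toWord ++ .inr ⟨c.2, hl c List.mem_cons_self⟩ ::
      (ofWord (c.1⁻¹).toWord ++ V), ?_, ?_, ?_⟩
    · simp [h₁, mk_toWord, mul_assoc, -toWord_inv]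
    · simp [h₂, mk_toWord, -toWord_inv]
    · simp [h₃]

end MarkedLetter

end FreeGroup

lemma exists_exprOf_of_mem_normalClosure {X : Type*} {R : Set (FreeGroup X)} {w : FreeGroup X}
    (hw : w ∈ Subgroup.normalClosure R) : ∃ n, ExprOf R w n := by
  induction hw using Subgroup.closure_induction with
  | mem x hx =>
    obtain ⟨r, hr, hc⟩ := Group.mem_conjugatesOfSet_iff.1 hx
    obtain ⟨c, rfl⟩ := isConj_iff.1 hc
    exact ⟨1, [(c, r)], rfl, by simp [hr], by simp⟩
  | one => exact ⟨0, [], rfl, by simp, rfl⟩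
  | mul x y _ _ hx hy =>
    obtain ⟨_, l, rfl, hl, rfl⟩ := hx
    obtain ⟨_, m, rfl, hm, rfl⟩ := hy
    exact ⟨_, l ++ m, rfl, fun p hp => (List.mem_append.1 hp).elim (hl p) (hm p), by simp⟩
  | inv x _ hx =>
    obtain ⟨_, l, rfl, hl, rfl⟩ := hx
    refine ⟨_, (l.map fun p => (p.1, p.2⁻¹)).reverse, rfl, ?_, ?_⟩
    · intro p hp
      obtain ⟨q, hq, rfl⟩ := List.mem_map.1 (List.mem_reverse.1 hp)
      simpa [or_comm] using hl q hq
    · rw [List.prod_inv_reverse]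
      simp [Function.comp_def, mul_assoc]

/-- **The Bounded Noise Lemma.**  Let `⟨X | R⟩` be a finite presentation and `L` a bound for
the reduced lengths of the relators.  If `w` is null-homotopic with `Area(w) = N`, then there
are `u₁, …, u_N` and relators `r₁, …, r_N ∈ R ∪ R⁻¹` with `w = ∏ uᵢ rᵢ uᵢ⁻¹` and
`‖u₁‖ + ∑ ‖uᵢ⁻¹ u_{i+1}‖ + ‖u_N‖ ≤ ‖w‖ + 2LN`. -/
theorem bounded_noise_lemma {X : Type} [Finite X] (R : Set (FreeGroup X)) (hRfin : R.Finite)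
    (L : ℕ) (hL : ∀ r ∈ R, fgNorm r ≤ L)
    (w : FreeGroup X) (hw : w ∈ Subgroup.normalClosure R)
    (N : ℕ) (hN : area R w = N) :
    ∃ u r : ℕ → FreeGroup X,
      (∀ i < N, r i ∈ R ∨ (r i)⁻¹ ∈ R) ∧
      ((List.range N).map fun i => u i * r i * (u i)⁻¹).prod = w ∧
      (0 < N →
        fgNorm (u 0) +
            (((List.range (N - 1)).map fun i => fgNorm ((u i)⁻¹ * u (i + 1))).sum) +
            fgNorm (u (N - 1)) ≤ fgNorm w + 2 * L * N) := by
  classical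
  obtain ⟨l₀, hlen₀, hl₀, hprod₀⟩ : ExprOf R w N :=
    hN ▸ Nat.sInf_mem (exists_exprOf_of_mem_normalClosure hw)
  have hnorm : ∀ r : FreeGroup X, FreeGroup.norm r = fgNorm r := fun r => by
    unfold fgNorm; congr
  have hL' : ∀ r ∈ {r | r ∈ R ∨ r⁻¹ ∈ R}, FreeGroup.norm r ≤ L := by
    rintro r (hr | hr)
    · exact (hnorm r).trans_le (hL r hr)
    · rw [← FreeGroup.norm_inv_eq]
      exact (hnorm _).trans_le (hL _ hr)
  obtain ⟨V₀, h₁, h₂, h₃⟩ := FreeGroup.MarkedLetter.exists_eval_eq_prod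
    (S := {r | r ∈ R ∨ r⁻¹ ∈ R}) l₀ hl₀
  obtain ⟨V, hfull, hbare, hle, hletters⟩ := FreeGroup.MarkedLetter.hasThin_eval_full hL' V₀ h₂
  rw [h₁, hprod₀] at hfull hletters
  rw [h₃, hlen₀] at hle
  set l := FreeGroup.MarkedLetter.conjugates 1 V with hl
  have hmem : ∀ c ∈ l, c.2 ∈ R ∨ c.2⁻¹ ∈ R := fun c hc => FreeGroup.MarkedLetter.mem_of_mem_conjugates hc
  have hprod : (l.map fun c => c.1 * c.2 * c.1⁻¹).prod = w := by
    rw [hl, FreeGroup.MarkedLetter.prod_conjugates, hfull, hbare]; simp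
  have hlen : l.length = N := by
    refine le_antisymm ((FreeGroup.MarkedLetter.length_conjugates 1 V).trans_le hle) ?_
    rw [← hN]
    exact Nat.sInf_le ⟨l, rfl, hmem, hprod⟩
  have hnoise := FreeGroup.MarkedLetter.noise_conjugates_le 1 1 V
  rw [← FreeGroup.MarkedLetter.length_conjugates 1 V, ← hl, hlen] at hletters
  rw [hbare, ← hl] at hnoise
  refine ⟨fun i => (l.getD i (1, 1)).1, fun i => (l.getD i (1, 1)).2, ?_, ?_, ?_⟩
  · intro i hi
    rw [← hlen] at hi
    dsimp only
    rw [List.getD_eq_getElem _ _ hi]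
    exact hmem _ (List.getElem_mem hi)
  · rw [← hprod, ← hlen]
    congr 1
    refine List.ext_getElem (by simp) fun i hi _ => ?_
    have hi : i < l.length := by simpa using hi
    simp [hi]
  · intro hpos
    clear_value l
    obtain ⟨c, m, rfl⟩ := List.exists_cons_of_length_pos (hlen ▸ hpos)
    rw [FreeGroup.MarkedLetter.noise_cons_eq] at hnoise
    obtain rfl : m.length + 1 = N := by simpa using hlen
    simp only [mul_one, inv_one, one_mul, FreeGroup.norm_one, zero_add, FreeGroup.norm_inv_eq] at hnoise
    simp only [hnorm] at hnoise hletters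
    rw [Nat.add_sub_cancel]
    exact hnoise.trans hletters
end

section
/- Let Γ_1, …, Γ_n be finitely presented groups with n ≥ 3, let A be a finitely generated free abelian group, and let θ : Γ_1 × … × Γ_n → A be a homomorphism whose restriction to each coordinate subgroup Γ_i is surjective. Then ker θ is finitely presented. -/
open Subgroup

section Hall

open scoped IsMulCommutative

variable {P : Type*} [Group P] (M : Subgroup P) [M.Normal] [IsMulCommutative M]

/-- The conjugation action of `P` on an abelian normal subgroup `M`, as an integral
representation of the abelianization of `P`, when commutators centralize `M`. -/
def conjRep (hc : _root_.commutator P ≤ centralizer (M : Set P)) :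
    Representation ℤ (Abelianization P) (Additive M) :=
  QuotientGroup.lift (_root_.commutator P)
    { toFun := fun g =>
        (MonoidHom.toAdditive (MulAut.conjNormal g : MulAut M).toMonoidHom).toIntLinearMap
      map_one' := by ext; simp
      map_mul' := fun a b => by ext; simp }
    (by
      intro c hcc
      rw [MonoidHom.mem_ker]
      refine LinearMap.ext fun v => ?_
      have h := mem_centralizer_iff.1 (hc hcc) (v.toMul : P) v.toMul.2
      have : MulAut.conjNormal c v.toMul = v.toMul := by
        ext
        rw [MulAut.conjNormal_apply, ← h, mul_inv_cancel_right]
      exact congrArg Additive.ofMul this)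

/-- The submodule of the conjugation module `M` consisting of the elements of a normal
subgroup `Y`. -/
def normalSubrep (hc : _root_.commutator P ≤ centralizer (M : Set P)) (Y : Subgroup P) [Y.Normal] :
    Subrepresentation (conjRep M hc) where
  toSubmodule := AddSubgroup.toIntSubmodule (Subgroup.toAddSubgroup (Y.subgroupOf M))
  apply_mem_toSubmodule := by
    intro g v hv
    obtain ⟨g, rfl⟩ := QuotientGroup.mk_surjective g
    exact ‹Y.Normal›.conj_mem _ hv g

theorem conjRep_finite (hc : _root_.commutator P ≤ centralizer (M : Set P))
    (hM : M.IsFinitelyNormallyGenerated) :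
    Module.Finite (MonoidAlgebra ℤ (Abelianization P)) (conjRep M hc).asModule := by
  obtain ⟨S, hS, hSM⟩ := hM
  have hSM' : S ⊆ M := hSM ▸ subset_normalClosure
  let S' : Set (conjRep M hc).asModule := {v | ((Additive.toMul (α := M) v : M) : P) ∈ S}
  have hS' : S'.Finite := hS.preimage (f := fun v : (conjRep M hc).asModule =>
    ((Additive.toMul (α := M) v : M) : P)) (by
      intro a _ b _ h
      exact Subtype.val_injective h)
  refine ⟨⟨hS'.toFinset, ?_⟩⟩
  rw [hS'.coe_toFinset]
  let N := Submodule.span (MonoidAlgebra ℤ (Abelianization P)) S'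
  let T : Subgroup P :=
    { carrier := {p | ∃ h : p ∈ M, (Additive.ofMul (⟨p, h⟩ : M) : (conjRep M hc).asModule) ∈ N}
      one_mem' := ⟨one_mem M, N.zero_mem⟩
      mul_mem' := by
        rintro a b ⟨ha, ha'⟩ ⟨hb, hb'⟩
        exact ⟨mul_mem ha hb, N.add_mem ha' hb'⟩
      inv_mem' := by
        rintro a ⟨ha, ha'⟩
        exact ⟨inv_mem ha, N.neg_mem ha'⟩ }
  have hT : T.Normal := by
    refine ⟨?_⟩
    rintro a ⟨ha, ha'⟩ g
    refine ⟨‹M.Normal›.conj_mem _ ha g, ?_⟩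
    have e := (Representation.single_smul (ρ := conjRep M hc) (1 : ℤ) (Abelianization.of g)
      (Additive.ofMul (⟨a, ha⟩ : M))).trans (one_smul ℤ _)
    exact Eq.mp (congrArg (· ∈ N) e) (N.smul_mem _ ha')
  have hMT : M ≤ T := by
    conv_lhs => rw [← hSM]
    exact normalClosure_le_normal fun s hs => ⟨hSM' hs, Submodule.subset_span hs⟩
  rw [eq_top_iff]
  rintro v -
  obtain ⟨_, h⟩ := hMT (Additive.toMul (α := M) v).2
  exact h

/-- **P. Hall**: an abelian normal subgroup `M`, finitely generated as a normal subgroup and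
centralized by commutators, satisfies the maximal condition on normal subgroups. -/
theorem Subgroup.IsFinitelyNormallyGenerated.of_le_abelian [Group.FG P]
    (hc : _root_.commutator P ≤ centralizer (M : Set P))
    (hM : M.IsFinitelyNormallyGenerated) {Z : Subgroup P} [Z.Normal] (hZ : Z ≤ M) :
    Z.IsFinitelyNormallyGenerated := by
  have := conjRep_finite M hc hM
  have : Group.FG (Abelianization P) := QuotientGroup.fg _
  have : IsNoetherianRing (MonoidAlgebra ℤ (Abelianization P)) :=
    Algebra.FiniteType.isNoetherianRing ℤ _
  obtain ⟨s, hs⟩ := IsNoetherian.noetherian (normalSubrep M hc Z).asSubmodule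
  let f : (conjRep M hc).asModule → P := fun v => ((Additive.toMul (α := M) v : M) : P)
  refine ⟨f '' s, s.finite_toSet.image f, le_antisymm (normalClosure_le_normal ?_) ?_⟩
  · rintro _ ⟨v, hv, rfl⟩
    have : v ∈ (normalSubrep M hc Z).asSubmodule := hs ▸ Submodule.subset_span hv
    exact this
  · intro z hz
    have hz' : (Additive.ofMul (⟨z, hZ hz⟩ : M) : (conjRep M hc).asModule) ∈
        (normalSubrep M hc Z).asSubmodule := hz
    have hle : (normalSubrep M hc Z).asSubmodule ≤
        (normalSubrep M hc (normalClosure (f '' s))).asSubmodule := by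
      rw [← hs, Submodule.span_le]
      intro v hv
      exact subset_normalClosure (Set.mem_image_of_mem f hv)
    exact hle hz'

end Hall

section Splitting

/-- A surjection onto a free group splits. -/
theorem IsFreeGroup.exists_section {G F : Type*} [Group G] [Group F] [IsFreeGroup F]
    (f : G →* F) (hf : Function.Surjective f) : ∃ s : F →* G, f.comp s = MonoidHom.id F := by
  refine ⟨IsFreeGroup.lift fun a => Function.surjInv hf (IsFreeGroup.of a), ?_⟩
  refine IsFreeGroup.ext_hom fun a => ?_
  simp [Function.surjInv_eq]

/-- A central kernel of a map onto a free group meets the commutator subgroup trivially. -/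
theorem IsFreeGroup.eq_one_of_mem_commutator_of_mem_ker {M F : Type*} [Group M] [Group F]
    [IsFreeGroup F] (f : M →* F) (hf : Function.Surjective f) (hz : f.ker ≤ center M)
    {c : M} (hc : c ∈ _root_.commutator M) (hcf : c ∈ f.ker) : c = 1 := by
  obtain ⟨s, hs⟩ := IsFreeGroup.exists_section f hf
  have hs' : ∀ x, f (s x) = x := fun x => DFunLike.congr_fun hs x
  have hmem : ∀ m, m * (s (f m))⁻¹ ∈ f.ker := fun m => by simp [MonoidHom.mem_ker, hs']
  let r : M →* M :=
    { toFun := fun m => m * (s (f m))⁻¹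
      map_one' := by simp
      map_mul' := fun a b => by
        have h := mem_center_iff.1 (hz (hmem b)) (s (f a))⁻¹
        simp only [map_mul, mul_inv_rev]
        rw [mul_assoc a (s (f a))⁻¹, h]
        group }
  have hr : r c = 1 := by
    have h : _root_.commutator M ≤ r.ker := by
      rw [commutator_eq_closure, closure_le]
      rintro _ ⟨a, b, rfl⟩
      rw [SetLike.mem_coe, MonoidHom.mem_ker, map_commutatorElement,
        commutatorElement_eq_one_iff_mul_comm]
      exact mem_center_iff.1 (hz (hmem b)) _
    exact h hc
  have : r c = c * (s (f c))⁻¹ := rfl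
  rw [this, MonoidHom.mem_ker.1 hcf] at hr
  simpa using hr

/-- If `q` maps to a free group and its kernel commutes with a finitely normally generated `M`,
and `q.ker ⊔ M` contains all commutators, then `q.ker ⊓ M` is finitely normally generated. -/
theorem Subgroup.IsFinitelyNormallyGenerated.ker_inf_of_isFreeGroup {P F : Type*} [Group P]
    [Group.FG P] [Group F] [IsFreeGroup F] (q : P →* F) (M : Subgroup P) [M.Normal]
    (hM : M.IsFinitelyNormallyGenerated) (hqM : q.ker ≤ centralizer (M : Set P))
    (hcomm : _root_.commutator P ≤ q.ker ⊔ M) :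
    (q.ker ⊓ M).IsFinitelyNormallyGenerated := by
  let D : Subgroup P := ⁅M, M⁆
  have hDM : D ≤ M := commutator_le_left M M
  let π : P →* P ⧸ D := QuotientGroup.mk' D
  have hπ : Function.Surjective π := QuotientGroup.mk'_surjective D
  have hπD : ∀ x, π x = 1 ↔ x ∈ D := fun x => QuotientGroup.eq_one_iff x
  have : (M.map π).Normal := ‹M.Normal›.map π hπ
  have : ((q.ker ⊓ M).map π).Normal := Normal.map inferInstance π hπ
  have hcen : M.map π ≤ centralizer (M.map π : Set (P ⧸ D)) := by
    rintro _ ⟨a, ha, rfl⟩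
    rw [mem_centralizer_iff]
    rintro _ ⟨b, hb, rfl⟩
    rw [← commutatorElement_eq_one_iff_mul_comm, ← map_commutatorElement, hπD]
    exact commutator_mem_commutator hb ha
  have : IsMulCommutative (M.map π) :=
    ⟨⟨fun a b => Subtype.ext (mem_centralizer_iff.1 (hcen b.2) a a.2)⟩⟩
  have hc : _root_.commutator (P ⧸ D) ≤ centralizer (M.map π : Set (P ⧸ D)) := by
    rw [_root_.commutator_def, ← map_top_of_surjective π hπ, ← map_commutator,
      ← _root_.commutator_def]
    refine (map_mono hcomm).trans ?_
    rw [map_sup]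
    refine sup_le ?_ hcen
    rintro _ ⟨a, ha, rfl⟩
    rw [mem_centralizer_iff]
    rintro _ ⟨b, hb, rfl⟩
    rw [← map_mul, ← map_mul, mem_centralizer_iff.1 (hqM ha) b hb]
  obtain ⟨S, hS, hSZ⟩ := IsFinitelyNormallyGenerated.of_le_abelian (M.map π) hc (hM.map hπ)
    (map_mono (inf_le_right : q.ker ⊓ M ≤ M))
  have hSsub : S ⊆ π '' ((q.ker ⊓ M : Subgroup P) : Set P) := by
    rw [← coe_map, ← hSZ]
    exact subset_normalClosure
  obtain ⟨S', hS'sub, hS', rfl⟩ : ∃ S' ⊆ ((q.ker ⊓ M : Subgroup P) : Set P), S'.Finite ∧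
      S = π '' S' :=
    Set.exists_subset_image_finite_and.1 ⟨S, hSsub, hS, rfl⟩
  have hle : normalClosure S' ≤ q.ker ⊓ M := normalClosure_le_normal hS'sub
  refine ⟨S', hS', le_antisymm hle fun z hz => ?_⟩
  have hz' : π z ∈ (normalClosure S').map π := by
    rw [map_normalClosure _ _ hπ, hSZ]
    exact mem_map_of_mem π hz
  obtain ⟨y, hy, hyz⟩ := hz'
  have hd : y⁻¹ * z ∈ D := by rw [← hπD, map_mul, map_inv, hyz, inv_mul_cancel]
  have hd' : y⁻¹ * z ∈ q.ker := mul_mem (inv_mem (hle hy).1) hz.1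
  let f : M →* M.map q := q.subgroupMap M
  have hone : (⟨y⁻¹ * z, hDM hd⟩ : M) = 1 := by
    refine IsFreeGroup.eq_one_of_mem_commutator_of_mem_ker f (q.subgroupMap_surjective M) ?_ ?_ ?_
    · intro a ha
      rw [mem_center_iff]
      intro b
      have ha' : (a : P) ∈ q.ker := congrArg Subtype.val ha
      exact Subtype.ext (mem_centralizer_iff.1 (hqM ha') b b.2)
    · have : y⁻¹ * z ∈ (_root_.commutator M).map M.subtype := by
        rwa [map_subtype_commutator]
      obtain ⟨w, hw, hwz⟩ := this
      exact (show (⟨y⁻¹ * z, hDM hd⟩ : M) = w from Subtype.ext hwz.symm) ▸ hw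
    · exact Subtype.ext hd'
  have : y⁻¹ * z = 1 := congrArg Subtype.val hone
  rwa [← inv_mul_eq_one.1 this]

end Splitting

section FinitePresentation

theorem Group.IsFinitelyPresented.fg {G : Type*} [Group G] [h : Group.IsFinitelyPresented G] :
    Group.FG G := by
  obtain ⟨n, φ, hφ, -⟩ := h
  exact Group.fg_of_surjective hφ

/-- A subgroup is normal if it is stable under conjugation by a set generating the group
as a monoid. -/
theorem Subgroup.normal_of_monoid_generators {G : Type*} [Group G] {X : Set G}
    (hX : Submonoid.closure X = ⊤) {H : Subgroup G}
    (h : ∀ x ∈ X, ∀ y ∈ H, x * y * x⁻¹ ∈ H) : H.Normal := by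
  refine ⟨fun y hy g => ?_⟩
  have hg : g ∈ Submonoid.closure X := hX ▸ Submonoid.mem_top g
  induction hg using Submonoid.closure_induction generalizing y with
  | mem x hx => exact h x hx y hy
  | one => simpa using hy
  | mul a b _ _ iha ihb => simpa [mul_assoc] using iha _ (ihb y hy)

/-- The kernel of a surjection from a finitely generated group onto a finitely presented one
is finitely generated as a normal subgroup. -/
theorem Group.IsFinitelyPresented.ker_isFinitelyNormallyGenerated {H G : Type*} [Group H] [Group G]
    [Group.FG H] [hG : Group.IsFinitelyPresented G] (f : H →* G) (hf : Function.Surjective f) :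
    f.ker.IsFinitelyNormallyGenerated := by
  obtain ⟨n, φ, hφ, R, hR, hRφ⟩ := hG
  obtain ⟨X, hX, hXfin⟩ := Group.fg_iff.1 ‹Group.FG H›
  obtain ⟨ψ, hψ⟩ : ∃ ψ : FreeGroup (Fin n) →* H, ∀ w, f (ψ w) = φ w := by
    refine ⟨FreeGroup.lift fun i => Function.surjInv hf (φ (FreeGroup.of i)), fun w => ?_⟩
    refine DFunLike.congr_fun (f := f.comp _) (g := φ) (FreeGroup.ext_hom _ _ fun i => ?_) w
    simp [Function.surjInv_eq]
  choose v hv using fun h => hφ (f h)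
  let N := normalClosure (ψ '' R ∪ (fun h => h⁻¹ * ψ (v h)) '' X)
  have hNf : N ≤ f.ker := by
    refine normalClosure_le_normal ?_
    rintro _ (⟨r, hr, rfl⟩ | ⟨h, -, rfl⟩)
    · have : r ∈ φ.ker := hRφ ▸ subset_normalClosure hr
      simpa [MonoidHom.mem_ker, hψ] using this
    · simp [MonoidHom.mem_ker, hψ, hv]
  refine ⟨_, (hR.image _).union (hXfin.image _), le_antisymm hNf fun h hh => ?_⟩
  have hker : φ.ker ≤ N.comap ψ := by
    rw [← hRφ]
    exact normalClosure_le_normal fun r hr => subset_normalClosure (Or.inl ⟨r, hr, rfl⟩)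
  have hall : ∀ h, ∃ w, h⁻¹ * ψ w ∈ N := by
    have : ((QuotientGroup.mk' N).comp ψ).range.comap (QuotientGroup.mk' N) = ⊤ := by
      rw [eq_top_iff, ← hX, closure_le]
      intro h hh
      have hmem : h⁻¹ * ψ (v h) ∈ N := subset_normalClosure (Or.inr ⟨h, hh, rfl⟩)
      exact ⟨v h, (QuotientGroup.eq.2 hmem).symm⟩
    intro h
    obtain ⟨w, hw⟩ : h ∈ ((QuotientGroup.mk' N).comp ψ).range.comap (QuotientGroup.mk' N) :=
      this ▸ mem_top h
    exact ⟨w, QuotientGroup.eq.1 hw.symm⟩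
  obtain ⟨w, hw⟩ := hall h
  have hwφ : w ∈ φ.ker := by
    have := hNf hw
    rw [MonoidHom.mem_ker, map_mul, map_inv, MonoidHom.mem_ker.1 hh, hψ] at this
    simpa [MonoidHom.mem_ker] using this
  have hψw : ψ w ∈ N := hker hwφ
  simpa using mul_mem hψw (inv_mem hw)

/-- If generating sets commute, then so do the subgroups they generate. -/
theorem Subgroup.closure_le_centralizer_closure {G : Type*} [Group G] {X Y : Set G}
    (h : ∀ x ∈ X, ∀ y ∈ Y, y * x = x * y) :
    closure X ≤ centralizer (closure Y : Set G) := by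
  rw [closure_le, centralizer_closure]
  exact fun x hx => mem_centralizer_iff.2 fun y hy => h x hx y hy

instance Group.IsFinitelyPresented.prod {G H : Type*} [Group G] [Group H]
    [Group.IsFinitelyPresented G] [Group.IsFinitelyPresented H] :
    Group.IsFinitelyPresented (G × H) := by
  obtain ⟨X, hX, hXfin⟩ := Group.fg_iff.1 (Group.IsFinitelyPresented.fg (G := G))
  obtain ⟨Y, hY, hYfin⟩ := Group.fg_iff.1 (Group.IsFinitelyPresented.fg (G := H))
  let a : G →* Monoid.Coprod G H := Monoid.Coprod.inl
  let b : H →* Monoid.Coprod G H := Monoid.Coprod.inr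
  let R : Set (Monoid.Coprod G H) := Set.image2 (fun x y => a x * b y * (b y * a x)⁻¹) X Y
  let N : Subgroup (Monoid.Coprod G H) := normalClosure R
  refine .of_surjective (G := Monoid.Coprod G H) Monoid.Coprod.toProd
    Monoid.Coprod.toProd_surjective
    ⟨R, hXfin.image2 _ hYfin, le_antisymm (normalClosure_le_normal ?_) ?_⟩
  · rintro _ ⟨x, -, y, -, rfl⟩
    simp [MonoidHom.mem_ker, a, b]
  · let π : Monoid.Coprod G H →* Monoid.Coprod G H ⧸ N := QuotientGroup.mk' N
    let f : G →* Monoid.Coprod G H ⧸ N := π.comp a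
    let g : H →* Monoid.Coprod G H ⧸ N := π.comp b
    have hcomm : f.range ≤ centralizer (g.range : Set (Monoid.Coprod G H ⧸ N)) := by
      rw [MonoidHom.range_eq_map, MonoidHom.range_eq_map, ← hX, ← hY, MonoidHom.map_closure,
        MonoidHom.map_closure]
      refine closure_le_centralizer_closure ?_
      rintro _ ⟨x, hx, rfl⟩ _ ⟨y, hy, rfl⟩
      have hmem : a x * b y * (b y * a x)⁻¹ ∈ N := subset_normalClosure ⟨x, hx, y, hy, rfl⟩
      have h : π (a x * b y * (b y * a x)⁻¹) = 1 := (QuotientGroup.eq_one_iff _).2 hmem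
      rw [map_mul, map_inv, mul_inv_eq_one] at h
      exact h.symm
    let k : G × H →* Monoid.Coprod G H ⧸ N := f.noncommCoprod g fun x y =>
      (mem_centralizer_iff.1 (hcomm ⟨x, rfl⟩) (g y) ⟨y, rfl⟩).symm
    have hkf : ∀ x, k (x, 1) = f x := fun x =>
      (congrArg (f x * ·) (map_one g)).trans (mul_one _)
    have hkg : ∀ y, k (1, y) = g y := fun y =>
      (congrArg (· * g y) (map_one f)).trans (one_mul _)
    have hfac : ∀ z : Monoid.Coprod G H, k (Monoid.Coprod.toProd z) = π z := fun z =>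
      DFunLike.congr_fun (f := k.comp Monoid.Coprod.toProd) (g := π)
        (Monoid.Coprod.hom_ext (MonoidHom.ext hkf) (MonoidHom.ext hkg)) z
    intro z hz
    have h : π z = 1 := by rw [← hfac, MonoidHom.mem_ker.1 hz, map_one]
    exact (QuotientGroup.eq_one_iff _).1 h

/-- Splitting the first coordinate off a product over `Fin (n + 1)`. -/
def Fin.consMulEquiv {n : ℕ} (Γ : Fin (n + 1) → Type*) [∀ i, Group (Γ i)] :
    (Γ 0 × ∀ i : Fin n, Γ i.succ) ≃* ∀ i, Γ i :=
  { Fin.consEquiv Γ with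
    map_mul' := fun a b => by
      ext i
      refine Fin.cases ?_ (fun j => ?_) i <;> rfl }

theorem Group.IsFinitelyPresented.pi_fin : ∀ {n : ℕ} (Γ : Fin n → Type*) [∀ i, Group (Γ i)]
    [∀ i, Group.IsFinitelyPresented (Γ i)], Group.IsFinitelyPresented (∀ i, Γ i)
  | 0, _, _, _ => inferInstance
  | _ + 1, Γ, _, _ =>
    have := pi_fin fun i => Γ i.succ
    .equiv (Fin.consMulEquiv Γ)

theorem Group.IsFinitelyPresented.multiplicative_of_free (A : Type*) [AddCommGroup A]
    [Module.Free ℤ A] [Module.Finite ℤ A] : Group.IsFinitelyPresented (Multiplicative A) := by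
  have := pi_fin fun _ : Fin (Module.finrank ℤ A) => Multiplicative ℤ
  let e : (Fin (Module.finrank ℤ A) → Multiplicative ℤ) ≃* Multiplicative A :=
    { (Module.finBasis ℤ A).equivFun.symm.toAddEquiv.toMultiplicative with }
  exact .equiv e

end FinitePresentation
section FibreProduct

variable {G H A : Type*} [Group G] [Group H] [CommGroup A]

theorem MonoidHom.mem_ker_coprod {α : G →* A} {β : H →* A} {x : G × H} :
    x ∈ (α.coprod β).ker ↔ α x.1 * β x.2 = 1 := Iff.rfl

/-- The fibre product of two finitely generated groups over a finitely presented abelian group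
is finitely generated. -/
theorem MonoidHom.fg_ker_coprod [Group.FG G] [Group.FG H] [Group.IsFinitelyPresented A]
    (α : G →* A) (β : H →* A) (hα : Function.Surjective α) (hβ : Function.Surjective β) :
    (α.coprod β).ker.FG := by
  obtain ⟨X, hX, hXfin⟩ := Group.fg_iff.1 ‹Group.FG G›
  obtain ⟨Y, hY, hYfin⟩ := Group.fg_iff.1 ‹Group.FG H›
  obtain ⟨S, hS, hSβ⟩ := Group.IsFinitelyPresented.ker_isFinitelyNormallyGenerated β hβ
  choose b hb using fun x => hβ (α x)⁻¹
  choose a ha using fun y => hα (β y)⁻¹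
  let U : Set (G × H) := (fun x => (x, b x)) '' X ∪ (fun y => (a y, y)) '' Y ∪
    (fun s => ((1 : G), s)) '' S
  have hle : closure U ≤ (α.coprod β).ker := by
    rw [closure_le]
    rintro _ ((⟨x, -, rfl⟩ | ⟨y, -, rfl⟩) | ⟨s, hs, rfl⟩)
    · simp [hb]
    · simp [ha]
    · have : s ∈ β.ker := hSβ ▸ subset_normalClosure hs
      simpa using this
  have hfst : ∀ g : G, ∃ h, (g, h) ∈ closure U := by
    have : (closure U).map (MonoidHom.fst G H) = ⊤ := by
      rw [eq_top_iff, ← hX, closure_le]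
      exact fun x hx => ⟨(x, b x), subset_closure (Or.inl (Or.inl ⟨x, hx, rfl⟩)), rfl⟩
    intro g
    obtain ⟨⟨g', h⟩, hz, rfl⟩ : g ∈ (closure U).map (MonoidHom.fst G H) := this ▸ mem_top g
    exact ⟨h, hz⟩
  have hsnd : ∀ h : H, ∃ g, (g, h) ∈ closure U := by
    have : (closure U).map (MonoidHom.snd G H) = ⊤ := by
      rw [eq_top_iff, ← hY, closure_le]
      exact fun y hy => ⟨(a y, y), subset_closure (Or.inl (Or.inr ⟨y, hy, rfl⟩)), rfl⟩
    intro h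
    obtain ⟨⟨g, h'⟩, hz, rfl⟩ : h ∈ (closure U).map (MonoidHom.snd G H) := this ▸ mem_top h
    exact ⟨g, hz⟩
  have hker : β.ker ≤ (closure U).comap (MonoidHom.inr G H) := by
    have hnormal : ((closure U).comap (MonoidHom.inr G H)).Normal := by
      refine ⟨fun y hy h => ?_⟩
      obtain ⟨g, hg⟩ := hsnd h
      have := mul_mem (mul_mem hg (mem_comap.1 hy)) (inv_mem hg)
      simpa using this
    rw [← hSβ]
    exact normalClosure_le_normal fun s hs => subset_closure (Or.inr ⟨s, hs, rfl⟩)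
  refine (Subgroup.fg_iff _).2 ⟨U, le_antisymm hle ?_,
    ((hXfin.image _).union (hYfin.image _)).union (hS.image _)⟩
  rintro ⟨g, h⟩ hgh
  obtain ⟨h', hh'⟩ := hfst g
  have h1 := MonoidHom.mem_ker_coprod.1 (mul_mem (inv_mem (hle hh')) hgh)
  have h2 : h'⁻¹ * h ∈ β.ker := by simpa using h1
  simpa using mul_mem hh' (mem_comap.1 (hker h2))

end FibreProduct

section FinitePresentationOfFibreProducts

/-- If `p` and `g` are surjections from a finitely generated group `K` to finitely presented groups
whose kernels commute, with the kernel of `p` finitely generated, then `K` has a finitely presented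
cover with the same commutation property. -/
theorem Group.exists_isFinitelyPresented_cover {K F G : Type*} [Group K] [Group F] [Group G] [Group.FG K]
    [Group.IsFinitelyPresented F] [Group.IsFinitelyPresented G] (p : K →* F) (g : K →* G)
    (hp : Function.Surjective p) (hg : Function.Surjective g) (hpfg : p.ker.FG)
    (hcomm : p.ker ≤ centralizer (g.ker : Set K)) :
    ∃ (P : Type) (_ : Group P) (_ : Group.IsFinitelyPresented P) (π : P →* K),
      Function.Surjective π ∧ (p.comp π).ker ≤ centralizer ((g.comp π).ker : Set P) := by
  obtain ⟨I, _, ψ, hψ⟩ := Group.fg_iff_exists_freeGroup_hom_surjective_finite.1 ‹Group.FG K›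
  obtain ⟨X, hX, hXfin⟩ := Monoid.fg_iff.1 (inferInstance : Monoid.FG (FreeGroup I))
  obtain ⟨T₀, hT₀, hT₀fin⟩ := (Subgroup.fg_iff _).1 hpfg
  let T : Set (FreeGroup I) := Function.surjInv hψ '' T₀
  have hTfin : T.Finite := hT₀fin.image _
  have hTψ : (closure T).map ψ = p.ker := by
    rw [MonoidHom.map_closure, ← hT₀, Set.image_image]
    simp [Function.surjInv_eq]
  have hTp : ∀ t ∈ closure T, p (ψ t) = 1 := fun t ht =>
    MonoidHom.mem_ker.1 (hTψ ▸ mem_map_of_mem ψ ht)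
  have hτ : ∀ x, ∃ t ∈ closure T, p (ψ x) = 1 → ψ t = ψ x := by
    intro x
    by_cases hx : p (ψ x) = 1
    · obtain ⟨t, ht, htx⟩ : ψ x ∈ (closure T).map ψ := hTψ ▸ hx
      exact ⟨t, ht, fun _ => htx⟩
    · exact ⟨1, one_mem _, fun h => absurd h hx⟩
  choose τ hτT hτψ using hτ
  obtain ⟨U, hUfin, hU⟩ := Group.IsFinitelyPresented.ker_isFinitelyNormallyGenerated (p.comp ψ)
    (hp.comp hψ)
  obtain ⟨S, hSfin, hS⟩ := Group.IsFinitelyPresented.ker_isFinitelyNormallyGenerated (g.comp ψ)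
    (hg.comp hψ)
  let R : Set (FreeGroup I) := (fun u => (τ u)⁻¹ * u) '' U ∪
    Set.image2 (fun x t => (τ (x * t * x⁻¹))⁻¹ * (x * t * x⁻¹)) X T ∪
    Set.image2 (fun t s => (t * s)⁻¹ * (s * t)) T S
  have hRfin : R.Finite := ((hUfin.image _).union (hXfin.image2 _ hTfin)).union
    (hTfin.image2 _ hSfin)
  let N := normalClosure R
  have hτψ' : ∀ x, p (ψ x) = 1 → (τ x)⁻¹ * x ∈ ψ.ker := fun x hx => by
    simp [MonoidHom.mem_ker, hτψ x hx]
  have hN : N ≤ ψ.ker := by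
    refine normalClosure_le_normal ?_
    rintro _ ((⟨u, hu, rfl⟩ | ⟨x, -, t, ht, rfl⟩) | ⟨t, ht, s, hs, rfl⟩)
    · have : u ∈ (p.comp ψ).ker := hU ▸ subset_normalClosure hu
      exact hτψ' u this
    · exact hτψ' _ (by simp [hTp t (subset_closure ht)])
    · have hs' : s ∈ (g.comp ψ).ker := hS ▸ subset_normalClosure hs
      have ht' : ψ t ∈ p.ker := hTp t (subset_closure ht)
      have := mem_centralizer_iff.1 (hcomm ht') (ψ s) hs'
      simp [MonoidHom.mem_ker, this]
  let κ : FreeGroup I →* FreeGroup I ⧸ N := QuotientGroup.mk' N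
  have hκ : Function.Surjective κ := QuotientGroup.mk'_surjective N
  have hκR : ∀ a b, a⁻¹ * b ∈ R → κ a = κ b := fun a b hab =>
    QuotientGroup.eq.2 (subset_normalClosure hab)
  let π : FreeGroup I ⧸ N →* K := QuotientGroup.lift N ψ hN
  have hπκ : ∀ x, π (κ x) = ψ x := fun _ => rfl
  let W := (closure T).map κ
  have hW : W.Normal := by
    refine normal_of_monoid_generators (X := κ '' X) ?_ ?_
    · rw [← MonoidHom.map_mclosure, hX, ← MonoidHom.mrange_eq_map, MonoidHom.mrange_eq_top]
      exact hκ
    · rintro _ ⟨x, hx, rfl⟩ y hy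
      have hle : W ≤ W.comap (MulAut.conj (κ x)).toMonoidHom := by
        rw [map_le_iff_le_comap, closure_le]
        intro t ht
        have : κ (τ (x * t * x⁻¹)) = κ (x * t * x⁻¹) :=
          hκR _ _ (Or.inl (Or.inr ⟨x, hx, t, ht, rfl⟩))
        rw [map_mul, map_mul, map_inv] at this
        have key : κ x * κ t * (κ x)⁻¹ ∈ W := this ▸ mem_map_of_mem κ (hτT _)
        exact key
      exact hle hy
  have hpW : (p.comp π).ker ≤ W := by
    intro y hy
    obtain ⟨z, rfl⟩ := hκ y
    have hz : z ∈ normalClosure U := hU ▸ hy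
    refine (normalClosure_le_normal fun u hu => ?_ : normalClosure U ≤ W.comap κ) hz
    have key : κ u ∈ W :=
      hκR (τ u) u (Or.inl (Or.inl ⟨u, hu, rfl⟩)) ▸ mem_map_of_mem κ (hτT _)
    exact key
  have hWS : W ≤ centralizer (κ '' S) := by
    rw [map_le_iff_le_comap, closure_le]
    intro t ht
    refine mem_centralizer_iff.2 ?_
    rintro _ ⟨s, hs, rfl⟩
    rw [← map_mul, ← map_mul]
    exact (hκR _ _ (Or.inr ⟨t, ht, s, hs, rfl⟩)).symm
  refine ⟨FreeGroup I ⧸ N, inferInstance, .quotient N ⟨R, hRfin, rfl⟩, π,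
    QuotientGroup.lift_surjective_of_surjective N ψ hψ hN, ?_⟩
  rw [le_centralizer_iff]
  intro y hy
  obtain ⟨z, rfl⟩ := hκ y
  have hz : z ∈ normalClosure S := hS ▸ hy
  refine (normalClosure_le_normal fun s hs => ?_ :
    normalClosure S ≤ (centralizer ((p.comp π).ker : Set (FreeGroup I ⧸ N))).comap κ) hz
  exact mem_centralizer_iff.2 fun w hw =>
    (mem_centralizer_iff.1 (hWS (hpW hw)) _ (Set.mem_image_of_mem κ hs)).symm

/-- The case of `MonoidHom.isFinitelyPresented_ker_coprod` in which the second factor is free. -/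
theorem MonoidHom.isFinitelyPresented_ker_coprod_of_isFreeGroup {G F A : Type*} [Group G] [Group F]
    [CommGroup A] [Group.IsFinitelyPresented G] [Group.IsFinitelyPresented F] [IsFreeGroup F]
    [Group.IsFinitelyPresented A] (α : G →* A) (β : F →* A) (hα : Function.Surjective α)
    (hβ : Function.Surjective β) (hαfg : α.ker.FG) :
    Group.IsFinitelyPresented (α.coprod β).ker := by
  let K := (α.coprod β).ker
  have := Group.IsFinitelyPresented.fg (G := G)
  have := Group.IsFinitelyPresented.fg (G := F)
  have : Group.FG K := (Group.fg_iff_subgroup_fg _).2 (MonoidHom.fg_ker_coprod α β hα hβ)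
  let p : K →* F := (MonoidHom.snd G F).comp K.subtype
  let g : K →* G := (MonoidHom.fst G F).comp K.subtype
  have hp : Function.Surjective p := fun y => by
    obtain ⟨x, hx⟩ := hα (β y)⁻¹
    exact ⟨⟨(x, y), by simp [K, hx]⟩, rfl⟩
  have hg : Function.Surjective g := fun x => by
    obtain ⟨y, hy⟩ := hβ (α x)⁻¹
    exact ⟨⟨(x, y), by simp [K, hy]⟩, rfl⟩
  have hpfg : p.ker.FG := by
    have : Group.FG α.ker := (Group.fg_iff_subgroup_fg _).2 hαfg
    let j : α.ker →* K := ((MonoidHom.inl G F).comp α.ker.subtype).codRestrict K fun x => by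
      have := MonoidHom.mem_ker.1 x.2
      simp [K, this]
    have hj : j.range = p.ker := by
      ext ⟨⟨x, y⟩, hxy⟩
      constructor
      · rintro ⟨z, hz⟩
        rw [← hz]
        rfl
      · intro h
        obtain rfl : y = 1 := h
        exact ⟨⟨x, by simpa [K] using hxy⟩, rfl⟩
    rw [← hj, ← Group.fg_iff_subgroup_fg]
    infer_instance
  have hcomm : p.ker ≤ centralizer (g.ker : Set K) := by
    rintro ⟨⟨x, y⟩, hxy⟩ h
    obtain rfl : y = 1 := h
    refine mem_centralizer_iff.2 ?_
    rintro ⟨⟨x', y'⟩, hxy'⟩ h'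
    obtain rfl : x' = 1 := h'
    simp
  obtain ⟨P, _, _, π, hπ, hcen⟩ := Group.exists_isFinitelyPresented_cover p g hp hg hpfg hcomm
  have := Group.IsFinitelyPresented.fg (G := P)
  have hcomm : _root_.commutator P ≤ (p.comp π).ker ⊔ (g.comp π).ker := by
    intro c hc
    have hβc : β (p (π c)) = 1 := Abelianization.commutator_subset_ker (β.comp (p.comp π)) hc
    obtain ⟨m, hm⟩ := hπ ⟨(1, p (π c)), by simp [K, hβc]⟩
    have hmg : g (π m) = 1 := by rw [hm]; rfl
    have hmp : p (π m) = p (π c) := by rw [hm]; rfl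
    have hcm : c * m⁻¹ ∈ (p.comp π).ker := by simp [MonoidHom.mem_ker, hmp]
    simpa using mul_mem_sup hcm (show m ∈ (g.comp π).ker from hmg)
  have hker : π.ker = (p.comp π).ker ⊓ (g.comp π).ker := by
    ext x
    constructor
    · intro hx
      exact ⟨(congrArg p hx).trans (map_one p), (congrArg g hx).trans (map_one g)⟩
    · exact fun hx => Subtype.ext (Prod.ext hx.2 hx.1)
  refine .of_surjective π hπ ?_
  rw [hker]
  exact .ker_inf_of_isFreeGroup _ _
    (Group.IsFinitelyPresented.ker_isFinitelyNormallyGenerated _ (hg.comp hπ)) hcen hcomm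

/-- The fibre product over a finitely presented abelian group of two finitely presented groups,
one of which has finitely generated kernel, is finitely presented. -/
theorem MonoidHom.isFinitelyPresented_ker_coprod {G H A : Type*} [Group G] [Group H]
    [CommGroup A] [Group.IsFinitelyPresented G] [Group.IsFinitelyPresented H]
    [Group.IsFinitelyPresented A] (α : G →* A) (β : H →* A) (hα : Function.Surjective α)
    (hβ : Function.Surjective β) (hαfg : α.ker.FG) :
    Group.IsFinitelyPresented (α.coprod β).ker := by
  obtain ⟨n, φ, hφ, R, hR, hRφ⟩ := ‹Group.IsFinitelyPresented H›
  have := MonoidHom.isFinitelyPresented_ker_coprod_of_isFreeGroup α (β.comp φ) hα (hβ.comp hφ) hαfg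
  let K := (α.coprod (β.comp φ)).ker
  let f : K →* (α.coprod β).ker :=
    (((MonoidHom.id G).prodMap φ).comp K.subtype).codRestrict _ fun x => x.2
  have hf : Function.Surjective f := by
    rintro ⟨⟨x, y⟩, hxy⟩
    obtain ⟨w, rfl⟩ := hφ y
    exact ⟨⟨(x, w), hxy⟩, rfl⟩
  have hmem : ∀ w ∈ φ.ker, ((1 : G), w) ∈ K := fun w hw => by
    simp [K, MonoidHom.mem_ker.1 hw]
  let S : Set K := {k | k.1.1 = 1 ∧ k.1.2 ∈ R}
  refine .of_surjective f hf ⟨S, ?_, le_antisymm (normalClosure_le_normal ?_) ?_⟩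
  · refine Set.Finite.of_finite_image (f := fun k : K => k.1.2) (hR.subset ?_) ?_
    · rintro _ ⟨k, hk, rfl⟩
      exact hk.2
    · exact fun k hk l hl h => Subtype.ext (Prod.ext (hk.1.trans hl.1.symm) h)
  · rintro k ⟨hk1, hk2⟩
    have : k.1.2 ∈ φ.ker := hRφ ▸ subset_normalClosure hk2
    exact Subtype.ext (Prod.ext hk1 this)
  · let V : Subgroup (FreeGroup (Fin n)) :=
      ((normalClosure S).map K.subtype).comap (MonoidHom.inr G (FreeGroup (Fin n)))
    have hV : V.Normal := by
      refine ⟨?_⟩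
      rintro w ⟨k, hk, hkw⟩ v
      obtain ⟨x, hx⟩ := hα (β (φ v))⁻¹
      let l : K := ⟨(x, v), by simp [K, hx]⟩
      refine ⟨l * k * l⁻¹, normalClosure_normal.conj_mem k hk l, ?_⟩
      have hkw' : (k : G × FreeGroup (Fin n)) = (1, w) := hkw
      simp [l, hkw']
    have hRV : φ.ker ≤ V := by
      rw [← hRφ]
      refine normalClosure_le_normal fun r hr => ?_
      exact ⟨⟨(1, r), hmem r (hRφ ▸ subset_normalClosure hr)⟩,
        subset_normalClosure ⟨rfl, hr⟩, rfl⟩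
    rintro ⟨⟨x, w⟩, hxw⟩ hk
    have hk' := congrArg Subtype.val (MonoidHom.mem_ker.1 hk)
    obtain rfl : x = 1 := congrArg Prod.fst hk'
    obtain ⟨k, hk, hkw⟩ := hRV (show w ∈ φ.ker from congrArg Prod.snd hk')
    exact (show k = ⟨(1, w), hxw⟩ from Subtype.ext hkw) ▸ hk

end FinitePresentationOfFibreProducts

section Pi

/-- `FinitelyPresentedGroup` agrees with Mathlib's notion. -/
theorem finitelyPresentedGroup_iff {G : Type*} [Group G] :
    FinitelyPresentedGroup G ↔ Group.IsFinitelyPresented G := by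
  constructor
  · rintro ⟨X, _, R, φ, hR, hφ, hker⟩
    exact .of_surjective φ hφ ⟨R, hR, hker.symm⟩
  · rintro ⟨n, φ, hφ, R, hR, hker⟩
    exact ⟨Fin n, inferInstance, R, φ, hR, hφ, hker.symm⟩

theorem MonoidHom.map_ker_comp_mulEquiv {G H A : Type*} [Group G] [Group H] [Group A]
    (e : G ≃* H) (f : H →* A) : (f.comp e.toMonoidHom).ker.map e.toMonoidHom = f.ker := by
  rw [← MonoidHom.comap_ker]
  exact map_comap_eq_self_of_surjective e.surjective _

variable {n : ℕ} {Γ : Fin (n + 1) → Type*} [∀ i, Group (Γ i)] {A : Type*} [CommGroup A]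

/-- The restriction of a homomorphism on a product over `Fin (n + 1)` to the last `n` factors. -/
def MonoidHom.piTail (θ : (∀ i, Γ i) →* A) : (∀ i : Fin n, Γ i.succ) →* A :=
  (θ.comp (Fin.consMulEquiv Γ).toMonoidHom).comp (MonoidHom.inr _ _)

theorem MonoidHom.piTail_comp_mulSingle (θ : (∀ i, Γ i) →* A) (i : Fin n) :
    θ.piTail.comp (MonoidHom.mulSingle (fun i : Fin n => Γ i.succ) i) =
      θ.comp (MonoidHom.mulSingle Γ i.succ) := by
  ext x
  refine congrArg θ (funext fun j => ?_)
  refine Fin.cases ?_ (fun j => ?_) j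
  · exact (Pi.mulSingle_eq_of_ne (Fin.succ_ne_zero i).symm x).symm
  · change Pi.mulSingle (M := fun i : Fin n => Γ i.succ) i x j = Pi.mulSingle i.succ x j.succ
    obtain rfl | h := eq_or_ne j i
    · simp
    · rw [Pi.mulSingle_eq_of_ne h, Pi.mulSingle_eq_of_ne ((Fin.succ_injective _).ne h)]

theorem MonoidHom.surjective_piTail (θ : (∀ i, Γ i) →* A) {i : Fin n}
    (h : Function.Surjective (θ.comp (MonoidHom.mulSingle Γ i.succ))) :
    Function.Surjective θ.piTail := by
  rw [← θ.piTail_comp_mulSingle] at h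
  exact .of_comp h

theorem MonoidHom.comp_consMulEquiv (θ : (∀ i, Γ i) →* A) :
    θ.comp ((Fin.consMulEquiv Γ).toMonoidHom.comp MulEquiv.prodComm.toMonoidHom) =
      θ.piTail.coprod (θ.comp (MonoidHom.mulSingle Γ 0)) := by
  refine (MonoidHom.coprod_unique _).symm.trans (congrArg₂ _ rfl ?_)
  ext x
  refine congrArg θ (funext fun j => ?_)
  refine Fin.cases ?_ (fun j => ?_) j
  · exact (Pi.mulSingle_eq_same 0 x).symm
  · exact (Pi.mulSingle_eq_of_ne (Fin.succ_ne_zero j) x).symm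

theorem MonoidHom.map_ker_coprod_piTail (θ : (∀ i, Γ i) →* A) :
    (θ.piTail.coprod (θ.comp (MonoidHom.mulSingle Γ 0))).ker.map
      (MulEquiv.prodComm.trans (Fin.consMulEquiv Γ)).toMonoidHom = θ.ker := by
  rw [← comp_consMulEquiv]
  exact map_ker_comp_mulEquiv (MulEquiv.prodComm.trans (Fin.consMulEquiv Γ)) θ

variable [∀ i, Group.IsFinitelyPresented (Γ i)] [Group.IsFinitelyPresented A]

/-- With at least two factors, the kernel is finitely generated. -/
theorem MonoidHom.fg_ker_pi (θ : (∀ i, Γ i) →* A) (hn : 1 ≤ n)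
    (hθ : ∀ i, Function.Surjective (θ.comp (MonoidHom.mulSingle Γ i))) : θ.ker.FG := by
  have := Group.IsFinitelyPresented.pi_fin fun i : Fin n => Γ i.succ
  have := Group.IsFinitelyPresented.fg (G := ∀ i : Fin n, Γ i.succ)
  have := Group.IsFinitelyPresented.fg (G := Γ 0)
  have := (Group.fg_iff_subgroup_fg _).2 <|
    fg_ker_coprod _ _ (θ.surjective_piTail (hθ (Fin.succ ⟨0, hn⟩))) (hθ 0)
  rw [← map_ker_coprod_piTail, ← Group.fg_iff_subgroup_fg]
  exact Group.fg_of_surjective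
    (f := ((MulEquiv.prodComm.trans (Fin.consMulEquiv Γ)).subgroupMap _).toMonoidHom)
    (MulEquiv.surjective _)

/-- With at least three factors, the kernel is finitely presented. -/
theorem MonoidHom.isFinitelyPresented_ker_pi (θ : (∀ i, Γ i) →* A) (hn : 2 ≤ n)
    (hθ : ∀ i, Function.Surjective (θ.comp (MonoidHom.mulSingle Γ i))) :
    Group.IsFinitelyPresented θ.ker := by
  have := Group.IsFinitelyPresented.pi_fin fun i : Fin n => Γ i.succ
  have hfg : θ.piTail.ker.FG := by
    obtain ⟨m, rfl⟩ := Nat.exists_eq_add_of_le' hn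
    exact fg_ker_pi (Γ := fun i => Γ i.succ) θ.piTail (by omega) fun i =>
      θ.piTail_comp_mulSingle i ▸ hθ i.succ
  have := MonoidHom.isFinitelyPresented_ker_coprod _ _
    (θ.surjective_piTail (hθ (Fin.succ ⟨0, by omega⟩))) (hθ 0) hfg
  rw [← map_ker_coprod_piTail]
  exact .equiv ((MulEquiv.prodComm.trans (Fin.consMulEquiv Γ)).subgroupMap _)

end Pi

/-- If `θ : Γ₁ × … × Γₙ → A` (`n ≥ 3`, each `Γᵢ` finitely presented, `A` finitely generated
free abelian) restricts to a surjection on every coordinate subgroup, then `ker θ` is finitely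
presented. -/
theorem kernel_finitely_presented
    (n : ℕ) (hn : 3 ≤ n) (Γ : Fin n → Type) [∀ i, Group (Γ i)]
    (hfp : ∀ i, FinitelyPresentedGroup (Γ i))
    (A : Type) [AddCommGroup A] [Module.Free ℤ A] [Module.Finite ℤ A]
    (θ : (∀ i, Γ i) →* Multiplicative A)
    (hsurj : ∀ i, Function.Surjective (θ.comp (MonoidHom.mulSingle Γ i))) :
    FinitelyPresentedGroup θ.ker := by
  obtain ⟨m, rfl⟩ := Nat.exists_eq_add_of_le' hn
  have := fun i => finitelyPresentedGroup_iff.1 (hfp i)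
  have := Group.IsFinitelyPresented.multiplicative_of_free A
  exact finitelyPresentedGroup_iff.2 (θ.isFinitelyPresented_ker_pi (by omega) hsurj)
end

section
/- Let H be a virtually-full, virtually-coabelian subgroup of a direct product D = Γ_1 × … × Γ_n, where each Γ_i is finitely generated and n ≥ 2. Then H is finitely generated, and for any choice of finite generating sets of H and of D there is a constant C ∈ ℕ such that the distortion function of H in D satisfies Δ(l) ≤ C·l² for all l. -/
open Subgroup

section WordMetric

variable {G G' : Type*} [Group G] [Group G']

theorem WordLe.one (S : Set G) (k : ℕ) : WordLe S 1 k :=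
  ⟨[], by simp, by simp, rfl⟩

theorem WordLe.of_mem {S : Set G} {g : G} (hg : g ∈ S) : WordLe S g 1 :=
  ⟨[g], by simp, by simp [hg], by simp⟩

theorem WordLe.mono {S : Set G} {g : G} {k m : ℕ} (h : WordLe S g k) (hkm : k ≤ m) :
    WordLe S g m := by
  obtain ⟨w, hw, hS, hg⟩ := h
  exact ⟨w, hw.trans hkm, hS, hg⟩

theorem WordLe.mono_set {S S' : Set G} (hS : S ⊆ S') {g : G} {k : ℕ} (h : WordLe S g k) :
    WordLe S' g k := by
  obtain ⟨w, hw, hwS, hg⟩ := h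
  exact ⟨w, hw, fun x hx => (hwS x hx).imp (@hS _) (@hS _), hg⟩

theorem WordLe.mul {S : Set G} {g h : G} {k m : ℕ} (hg : WordLe S g k) (hh : WordLe S h m) :
    WordLe S (g * h) (k + m) := by
  obtain ⟨v, hv, hvS, rfl⟩ := hg
  obtain ⟨w, hw, hwS, rfl⟩ := hh
  refine ⟨v ++ w, by simp; omega, fun x hx => ?_, by simp⟩
  rcases List.mem_append.1 hx with hx | hx
  exacts [hvS x hx, hwS x hx]

theorem WordLe.inv {S : Set G} {g : G} {k : ℕ} (hg : WordLe S g k) : WordLe S g⁻¹ k := by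
  obtain ⟨w, hw, hwS, rfl⟩ := hg
  refine ⟨(w.map (·⁻¹)).reverse, by simpa using hw, fun x hx => ?_, by
    rw [List.prod_inv_reverse]⟩
  simp only [List.mem_reverse, List.mem_map] at hx
  obtain ⟨y, hy, rfl⟩ := hx
  simpa [or_comm] using hwS y hy

/-- Words can be transported along a homomorphism at the cost of rewriting each generator. -/
theorem WordLe.map {S : Set G} {S' : Set G'} (f : G →* G') {c : ℕ}
    (hf : ∀ s ∈ S, WordLe S' (f s) c) {g : G} {k : ℕ} (hg : WordLe S g k) :
    WordLe S' (f g) (c * k) := by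
  obtain ⟨w, hw, hwS, rfl⟩ := hg
  refine WordLe.mono ?_ (Nat.mul_le_mul_left c hw)
  clear hw
  induction w with
  | nil => simpa using WordLe.one S' _
  | cons x w ih =>
    have hx : WordLe S' (f x) c := by
      rcases hwS x (by simp) with h | h
      · exact hf x h
      · simpa using (hf _ h).inv
    have := hx.mul (ih fun y hy => hwS y (by simp [hy]))
    rw [List.prod_cons, map_mul]
    exact this.mono (by rw [List.length_cons]; ring_nf; rfl)

theorem WordLe.mem {S : Set G} {K : Subgroup G} (hS : S ⊆ K) {g : G} {k : ℕ}
    (hg : WordLe S g k) : g ∈ K := by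
  obtain ⟨w, -, hwS, rfl⟩ := hg
  refine K.list_prod_mem fun x hx => ?_
  rcases hwS x hx with h | h
  exacts [hS h, K.inv_mem_iff.1 (hS h)]

theorem WordLe.restrict {S : Set G} {K : Subgroup G} (hS : S ⊆ K) {g : K} {k : ℕ}
    (hg : WordLe S (g : G) k) : WordLe ((↑) ⁻¹' S) g k := by
  obtain ⟨w, hw, hwS, hg⟩ := hg
  have hwK : ∀ x ∈ w, x ∈ K := fun x hx =>
    WordLe.mem (k := 1) hS ⟨[x], by simp, by simpa using hwS x hx, by simp⟩
  lift w to List K using hwK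
  refine ⟨w, by simpa using hw, fun x hx => ?_, ?_⟩
  · simpa using hwS x (List.mem_map_of_mem hx)
  · ext
    simpa using hg

theorem exists_wordLe_of_mem_closure {S : Set G} {g : G} (hg : g ∈ Subgroup.closure S) :
    ∃ k, WordLe S g k := by
  induction hg using Subgroup.closure_induction with
  | mem x hx => exact ⟨1, .of_mem hx⟩
  | one => exact ⟨0, .one S 0⟩
  | mul x y _ _ hx hy =>
    obtain ⟨k, hk⟩ := hx
    obtain ⟨m, hm⟩ := hy
    exact ⟨k + m, hk.mul hm⟩
  | inv x _ hx =>
    obtain ⟨k, hk⟩ := hx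
    exact ⟨k, hk.inv⟩

theorem Set.Finite.exists_wordLe {F S : Set G} (hF : F.Finite)
    (h : ∀ g ∈ F, ∃ k, WordLe S g k) : ∃ c, ∀ g ∈ F, WordLe S g c := by
  choose! k hk using h
  obtain ⟨c, hc⟩ := (hF.image k).bddAbove
  exact ⟨c, fun g hg => (hk g hg).mono (hc (Set.mem_image_of_mem k hg))⟩

theorem wordLe_wordLength {S : Set G} (hS : Subgroup.closure S = ⊤) (g : G) :
    WordLe S g (wordLength S g) :=
  Nat.sInf_mem (s := {k | WordLe S g k}) (exists_wordLe_of_mem_closure (hS ▸ Subgroup.mem_top g))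

theorem WordLe.wordLength_le {S : Set G} {g : G} {k : ℕ} (h : WordLe S g k) :
    wordLength S g ≤ k :=
  Nat.sInf_le h

/-- Schreier's lemma, with control on word lengths. -/
theorem exists_schreier_generators (K : Subgroup G) [K.FiniteIndex] {T : Set G} (hT : T.Finite) :
    ∃ T' : Set K, T'.Finite ∧
      ∀ (h : K) (l : ℕ), WordLe T (h : G) l → WordLe T' h (l + 2) := by
  let ρ : G → G := fun g => (g : G ⧸ K).out
  have hρ : ∀ g, (ρ g)⁻¹ * g ∈ K := fun g => by
    rw [← QuotientGroup.eq]
    exact Quotient.out_eq _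
  have hρc : ∀ g g' : G, (g : G ⧸ K) = g' → ρ g = ρ g' := fun g g' h => by
    simp only [ρ, h]
  have hfin : (Set.range ρ).Finite := by
    refine (Set.finite_range (fun q : G ⧸ K => q.out)).subset ?_
    rintro _ ⟨g, rfl⟩
    exact ⟨_, rfl⟩
  let X : Set G := insert (ρ 1) (Set.image2 (fun p x => p.1⁻¹ * x * p.2)
    (Set.range ρ ×ˢ Set.range ρ) (T ∪ T⁻¹))
  have hX : X.Finite := ((hfin.prod hfin).image2 _ (hT.union hT.inv)).insert _
  refine ⟨(↑) ⁻¹' X, hX.preimage Subtype.val_injective.injOn, ?_⟩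
  have key : ∀ w : List G, (∀ x ∈ w, x ∈ T ∨ x⁻¹ ∈ T) →
      WordLe ((↑) ⁻¹' X) (⟨_, hρ w.prod⟩ : K) (w.length + 1) := by
    intro w hw
    induction w with
    | nil =>
      have h1 : ρ 1 ∈ K := by simpa using hρ 1
      have : WordLe ((↑) ⁻¹' X) (⟨ρ 1, h1⟩ : K) 1 := .of_mem (Set.mem_insert _ _)
      convert this.inv using 1
      · ext
        simp
      · simp
    | cons x w ih =>
      have hx := hw x (by simp)
      have hmul : ρ (x * w.prod) = ρ (x * ρ w.prod) := hρc _ _ <| by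
        rw [QuotientGroup.eq, mul_inv_rev]
        have := K.inv_mem (hρ w.prod)
        rw [mul_inv_rev, inv_inv] at this
        simpa [mul_assoc] using this
      have hm : (ρ (x * w.prod))⁻¹ * x * ρ w.prod ∈ K := by
        rw [hmul, mul_assoc]
        exact hρ _
      have h1 : WordLe ((↑) ⁻¹' X) (⟨_, hm⟩ : K) 1 := .of_mem <| Set.mem_insert_of_mem _
        ⟨(ρ (x * w.prod), ρ w.prod), ⟨⟨_, rfl⟩, ⟨_, rfl⟩⟩, x, by simpa using hx, rfl⟩
      convert (h1.mul (ih fun y hy => hw y (by simp [hy]))).mono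
        (m := (x :: w).length + 1) (by simp; omega) using 1
      ext
      simp [mul_assoc]
  rintro h l ⟨w, hl, hw, hh⟩
  have h1 : ρ 1 ∈ K := by simpa using hρ 1
  have hρh : ρ h = ρ 1 := hρc _ _ <| by simp [QuotientGroup.eq]
  have h2 : WordLe ((↑) ⁻¹' X) (⟨ρ 1, h1⟩ : K) 1 := .of_mem (Set.mem_insert _ _)
  convert (h2.mul (key w hw)).mono (m := l + 2) (by omega) using 1
  ext
  simp [hh, hρh]

end WordMetric

section AbelianCover

open Multiplicative

theorem toAdd_map_list_prod_nonneg {E : Type*} [Group E] (f : E →* Multiplicative ℤ)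
    {w : List E} (hw : ∀ y ∈ w, 0 ≤ toAdd (f y)) : 0 ≤ toAdd (f w.prod) := by
  induction w with
  | nil => simp
  | cons x w ih =>
    rw [List.prod_cons, map_mul, toAdd_mul]
    exact add_nonneg (hw x (by simp)) (ih fun y hy => hw y (by simp [hy]))

/-- If each letter is either short in `S`, or can be cancelled against a later occurrence of its
inverse at linear cost, then words of length `k` in `M` have `S`-length at most `k ^ 2`. -/
theorem wordLe_sq_of_cancel {E : Type*} [Group E] {M : Subgroup E} {S Y : Set E}
    (hSM : S ⊆ M)
    (hY : ∀ x, x ∈ Y ∨ x⁻¹ ∈ Y → WordLe S x 1 ∨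
      ((∃ f : E →* Multiplicative ℤ, M ≤ f.ker ∧ 0 < toAdd (f x) ∧
        ∀ y, y ∈ Y ∨ y⁻¹ ∈ Y → toAdd (f y) < 0 → y = x⁻¹) ∧
      ∀ v k, WordLe Y v k → WordLe S (x * v * x⁻¹ * v⁻¹) (2 * k)))
    (w : List E) (hw : ∀ x ∈ w, x ∈ Y ∨ x⁻¹ ∈ Y) (hM : w.prod ∈ M) :
    WordLe S w.prod (w.length ^ 2) := by
  induction hn : w.length using Nat.strong_induction_on generalizing w with
  | _ n ih =>
  rcases w with _ | ⟨x, w⟩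
  · exact .one S _
  simp only [List.mem_cons, forall_eq_or_imp, List.length_cons, List.prod_cons] at *
  rcases hY x hw.1 with hx | ⟨⟨f, hMf, hfx, hf⟩, hcomm⟩
  · have hwM : w.prod ∈ M := (M.mul_mem_cancel_left (hx.mem hSM)).1 hM
    refine (hx.mul (ih w.length (by omega) w hw.2 hwM rfl)).mono ?_
    subst hn
    have : ∀ a : ℕ, 1 + a ^ 2 ≤ (a + 1) ^ 2 := fun a => by nlinarith [Nat.zero_le a]
    exact this _
  · have hmem : x⁻¹ ∈ w := by
      by_contra hcon
      have hnn : 0 ≤ toAdd (f w.prod) := toAdd_map_list_prod_nonneg f fun y hy => by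
        by_contra! hneg
        exact hcon (hf y (hw.2 y hy) hneg ▸ hy)
      have := hMf hM
      rw [MonoidHom.mem_ker, map_mul] at this
      have := congrArg toAdd this
      simp only [toAdd_mul, toAdd_one] at this
      omega
    obtain ⟨v, v', rfl⟩ := List.append_of_mem hmem
    have hv : WordLe Y v.prod v.length :=
      ⟨v, le_rfl, fun y hy => hw.2 y (by simp [hy]), rfl⟩
    have hc := hcomm _ _ hv
    have heq : x * (v ++ x⁻¹ :: v').prod =
        (x * v.prod * x⁻¹ * v.prod⁻¹) * (v ++ v').prod := by
      simp [mul_assoc]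
    rw [heq] at hM ⊢
    have hvM := (M.mul_mem_cancel_left (hc.mem hSM)).1 hM
    simp only [List.length_append, List.length_cons] at hn
    refine (hc.mul (ih (v ++ v').length (by simp; omega) (v ++ v')
      (fun y hy => hw.2 y ?_) hvM rfl)).mono ?_
    · simp only [List.mem_append, List.mem_cons] at hy ⊢
      tauto
    · simp only [List.length_append]
      subst hn
      have : ∀ a b : ℕ, 2 * a + (a + b) ^ 2 ≤ (a + (b + 1) + 1) ^ 2 := fun a b => by
        nlinarith [Nat.zero_le a, Nat.zero_le b]
      exact this _ _

/-- Quadratic bound on word lengths in a normal subgroup `M`, for words in the `b i` and `M`, when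
each `b i` agrees with an element `c i` of `M` modulo a normal subgroup `A` commuting with `b i`. -/
theorem exists_wordLe_sq_of_lifts {E : Type*} [Group E] (M A : Subgroup E) [M.Normal] [A.Normal]
    {ι : Type*} [Finite ι] (b c : ι → E) (hcM : ∀ i, c i ∈ M)
    (hbc : ∀ i, (b i)⁻¹ * c i ∈ A) (hbA : ∀ i, ∀ a ∈ A, Commute a (b i))
    (χ : ι → E →* Multiplicative ℤ) (hMχ : ∀ i, M ≤ (χ i).ker)
    (hpos : ∀ i, 0 < toAdd (χ i (b i))) (hne : ∀ i j, i ≠ j → χ i (b j) = 1)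
    {T : Set E} (hT : T.Finite) (hTM : ∀ t ∈ T, t ∈ Subgroup.closure (Set.range b) ⊔ M) :
    ∃ S : Set E, S.Finite ∧ S ⊆ M ∧
      ∃ C : ℕ, ∀ h ∈ M, ∀ l, WordLe T h l → WordLe S h ((C * l) ^ 2) := by
  have hdec : ∀ t ∈ T, ∃ m ∈ M, ∃ y ∈ Subgroup.closure (Set.range b), y * m = t := fun t ht => by
    obtain ⟨y, hy, m, hm, h⟩ := Subgroup.mem_sup_of_normal_right.1 (hTM t ht)
    exact ⟨m, hm, y, hy, h⟩
  choose! m hm using hdec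
  let Y : Set E := Set.range b ∪ m '' T
  let Z : Set E := Set.range c ∪ m '' T
  have hZ : Z.Finite := (Set.finite_range c).union (hT.image m)
  have hZM : Z ⊆ M := by
    rintro _ (⟨i, rfl⟩ | ⟨t, ht, rfl⟩)
    exacts [hcM i, (hm t ht).1]
  let S : Set E := Z ∪ Set.image2 (fun x z => x * z * x⁻¹) (Set.range b ∪ (Set.range b)⁻¹) Z
  have hS : S.Finite := hZ.union
    (((Set.finite_range b).union (Set.finite_range b).inv).image2 _ hZ)
  have hSM : S ⊆ M := by
    rintro _ (hz | ⟨x, -, z, hz, rfl⟩)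
    exacts [hZM hz, ‹M.Normal›.conj_mem z (hZM hz) x]
  refine ⟨S, hS, hSM, ?_⟩
  -- words in `Y` lift to words in `Z` with the same image modulo `A`
  have hlift : ∀ v k, WordLe Y v k → ∃ z, WordLe Z z k ∧ (v : E ⧸ A) = z := by
    rintro v k ⟨w, hw, hwY, rfl⟩
    suffices ∃ z, WordLe Z z w.length ∧ (w.prod : E ⧸ A) = z by
      obtain ⟨z, hz, h⟩ := this
      exact ⟨z, hz.mono hw, h⟩
    clear hw
    have hgen : ∀ y ∈ Y, ∃ z ∈ Z, (y : E ⧸ A) = z := by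
      rintro _ (⟨i, rfl⟩ | ht)
      · exact ⟨c i, .inl ⟨i, rfl⟩, QuotientGroup.eq.2 (hbc i)⟩
      · exact ⟨_, .inr ht, rfl⟩
    induction w with
    | nil => exact ⟨1, .one Z _, rfl⟩
    | cons x w ih =>
      obtain ⟨z, hz, hwz⟩ := ih fun y hy => hwY y (by simp [hy])
      obtain ⟨z', hz', hxz⟩ : ∃ z', WordLe Z z' 1 ∧ (x : E ⧸ A) = z' := by
        rcases hwY x (by simp) with h | h
        · obtain ⟨z', hz', h'⟩ := hgen x h
          exact ⟨z', .of_mem hz', h'⟩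
        · obtain ⟨z', hz', h'⟩ := hgen _ h
          refine ⟨z'⁻¹, (WordLe.of_mem hz').inv, ?_⟩
          rw [QuotientGroup.mk_inv, ← h', QuotientGroup.mk_inv, inv_inv]
      refine ⟨z' * z, (hz'.mul hz).mono (by simp; omega), ?_⟩
      rw [List.prod_cons, QuotientGroup.mk_mul, QuotientGroup.mk_mul, hxz, hwz]
  have hcomm : ∀ x ∈ Set.range b ∪ (Set.range b)⁻¹, ∀ v k, WordLe Y v k →
      WordLe S (x * v * x⁻¹ * v⁻¹) (2 * k) := by
    intro x hx v k hv
    obtain ⟨z, hz, hvz⟩ := hlift v k hv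
    have hxA : ∀ a ∈ A, Commute a x := by
      intro a ha
      rcases hx with ⟨i, rfl⟩ | ⟨i, hi⟩
      · exact hbA i a ha
      · exact Commute.inv_right_iff.1 (hi ▸ hbA i a ha)
    have hcx : z⁻¹ * v * x⁻¹ = x⁻¹ * (z⁻¹ * v) :=
      (hxA _ (QuotientGroup.eq.1 hvz.symm)).inv_right.eq
    have heq : x * v * x⁻¹ * v⁻¹ = (x * z * x⁻¹) * z⁻¹ := by
      calc x * v * x⁻¹ * v⁻¹ = x * z * (z⁻¹ * v * x⁻¹) * v⁻¹ := by group
        _ = (x * z * x⁻¹) * z⁻¹ := by rw [hcx]; group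
    rw [heq]
    have h1 : WordLe S (MulAut.conj x z) (1 * k) :=
      hz.map (MulAut.conj x).toMonoidHom fun s hs => .of_mem (.inr ⟨x, hx, s, hs, rfl⟩)
    have h2 := (hz.mono_set (Set.subset_union_left : Z ⊆ S)).inv
    exact (h1.mul h2).mono (by omega)
  have hχneg : ∀ i y, y ∈ Y ∨ y⁻¹ ∈ Y → χ i y = 1 ∨ y = b i ∨ y = (b i)⁻¹ := by
    have hgen : ∀ i, ∀ y ∈ Y, χ i y = 1 ∨ y = b i := by
      rintro i _ (⟨j, rfl⟩ | ⟨t, ht, rfl⟩)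
      · by_cases hij : i = j
        · exact .inr (by rw [hij])
        · exact .inl (hne i j hij)
      · exact .inl (hMχ i (hm t ht).1)
    rintro i y (hy | hy)
    · exact (hgen i y hy).imp_right .inl
    · rcases hgen i _ hy with h | h
      · exact .inl (by simpa using h)
      · exact .inr (.inr (by rw [← h, inv_inv]))
  have hY : ∀ x, x ∈ Y ∨ x⁻¹ ∈ Y → WordLe S x 1 ∨
      ((∃ f : E →* Multiplicative ℤ, M ≤ f.ker ∧ 0 < toAdd (f x) ∧
        ∀ y, y ∈ Y ∨ y⁻¹ ∈ Y → toAdd (f y) < 0 → y = x⁻¹) ∧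
      ∀ v k, WordLe Y v k → WordLe S (x * v * x⁻¹ * v⁻¹) (2 * k)) := by
    rintro x ((⟨i, rfl⟩ | hx) | (⟨i, hi⟩ | hx))
    · refine .inr ⟨⟨χ i, hMχ i, hpos i, fun y hy hneg => ?_⟩, hcomm _ (.inl ⟨i, rfl⟩)⟩
      have := hpos i
      rcases hχneg i y hy with h | rfl | h
      · simp [h] at hneg
      · omega
      · exact h
    · exact .inl (.of_mem (.inl (.inr hx)))
    · obtain rfl : x = (b i)⁻¹ := by rw [hi, inv_inv]
      have := hpos i
      refine .inr ⟨⟨(χ i)⁻¹, fun z hz => ?_, by simpa using this, fun y hy hneg => ?_⟩,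
        hcomm _ (.inr (by simp))⟩
      · simpa using hMχ i hz
      · rcases hχneg i y hy with h | h | rfl
        · simp [h] at hneg
        · simpa using h
        · simp at hneg
          omega
    · exact .inl (by simpa using (WordLe.of_mem (.inl (.inr hx)) : WordLe S x⁻¹ 1).inv)
  obtain ⟨C, hC⟩ := hT.exists_wordLe (S := Y) fun t ht => by
    obtain ⟨hmt, y, hy, h⟩ := hm t ht
    obtain ⟨k, hk⟩ := exists_wordLe_of_mem_closure hy
    refine ⟨k + 1, ?_⟩
    rw [← h]
    exact (hk.mono_set Set.subset_union_left).mul (.of_mem (.inr ⟨t, ht, rfl⟩))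
  refine ⟨C, fun h hh l hl => ?_⟩
  obtain ⟨w, hw, hwY, rfl⟩ := hl.map (S' := Y) (MonoidHom.id E) hC
  exact (wordLe_sq_of_cancel hSM hY w hwY hh).mono (Nat.pow_le_pow_left hw 2)

/-- A finitely generated abelian group has finitely many independent elements all of whose positive
powers generate subgroups of finite index. -/
theorem exists_independent_finiteIndex_closure (Q : Type*) [CommGroup Q] [Group.FG Q] :
    ∃ (r : ℕ) (q : Fin r → Q) (χ : Fin r → Q →* Multiplicative ℤ),
      (∀ i, χ i (q i) = ofAdd 1) ∧ (∀ i j, i ≠ j → χ i (q j) = 1) ∧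
      ∀ N : ℕ, 0 < N → (Subgroup.closure (Set.range fun i => q i ^ N)).FiniteIndex := by
  let F := Additive (Q ⧸ CommGroup.torsion Q)
  have : Module.Finite ℤ F := Module.Finite.iff_addGroup_fg.2 inferInstance
  let β := Module.finBasis ℤ F
  let χ : Fin (Module.finrank ℤ F) → Q →* Multiplicative ℤ := fun i =>
    (AddMonoidHom.toMultiplicativeRight (β.coord i).toAddMonoidHom).comp
      (QuotientGroup.mk' (CommGroup.torsion Q))
  have hχ : ∀ i x, χ i x = ofAdd (β.repr (Additive.ofMul (x : Q ⧸ CommGroup.torsion Q)) i) :=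
    fun i x => rfl
  choose q hq using fun i => QuotientGroup.mk_surjective (β i).toMul
  have hχq : ∀ i j, χ i (q j) = ofAdd (if j = i then 1 else 0) := fun i j => by
    rw [hχ, hq, ofMul_toMul, Module.Basis.repr_self, Finsupp.single_apply]
  refine ⟨_, q, χ, fun i => by simp [hχq], fun i j h => by simp [hχq, h.symm], fun N hN => ?_⟩
  set K := Subgroup.closure (Set.range fun i => q i ^ N)
  have hK : IsMulTorsion (Q ⧸ K) := by
    intro x
    obtain ⟨x, rfl⟩ := QuotientGroup.mk_surjective x
    let y := ∏ i, q i ^ toAdd (χ i x)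
    have hy : y ^ N ∈ K := by
      rw [← Finset.prod_pow]
      refine K.prod_mem fun i _ => ?_
      rw [← zpow_natCast, zpow_comm, zpow_natCast]
      exact K.zpow_mem (Subgroup.subset_closure ⟨i, rfl⟩) _
    have hxy : x * y⁻¹ ∈ CommGroup.torsion Q := by
      rw [← QuotientGroup.eq_one_iff]
      refine Additive.ofMul.injective (β.ext_elem fun i => ?_)
      apply ofAdd.injective
      rw [← hχ, map_mul, map_inv, map_prod, Finset.prod_eq_single i
        (fun j _ hj => by simp [hχq, hj]) (by simp), map_zpow, hχq, if_pos rfl, ← ofAdd_zsmul]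
      simp
    obtain ⟨n, hn, hxn⟩ := isOfFinOrder_iff_pow_eq_one.1 hxy
    refine isOfFinOrder_iff_pow_eq_one.2 ⟨N * n, Nat.mul_pos hN hn, ?_⟩
    rw [← QuotientGroup.mk_pow, QuotientGroup.eq_one_iff]
    have : x ^ (N * n) = ((x * y⁻¹) ^ n) ^ N * (y ^ N) ^ n := by
      rw [← pow_mul, ← pow_mul, mul_comm n N, ← mul_pow, inv_mul_cancel_right]
    rw [this, hxn, one_pow, one_mul]
    exact K.pow_mem hy n
  have : Finite (Q ⧸ K) := CommGroup.finite_of_fg_isMulTorsion _ hK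
  exact Subgroup.finiteIndex_of_finite_quotient

end AbelianCover

section Distortion

/-- The kernel of a homomorphism `φ` to an abelian group is at most quadratically distorted when
two commuting subgroups both have almost full image under `φ`. -/
theorem exists_wordLe_sq_ker {E Q : Type*} [Group E] [CommGroup Q] [Group.FG Q] (φ : E →* Q)
    (A B : Subgroup E) [A.Normal] (hAB : ∀ a ∈ A, ∀ b ∈ B, Commute a b)
    (hA : ∀ q : Q, ∃ n, 0 < n ∧ q ^ n ∈ A.map φ) (hB : ∀ q : Q, ∃ n, 0 < n ∧ q ^ n ∈ B.map φ)
    {T : Set E} (hT : T.Finite) :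
    ∃ S : Set E, S.Finite ∧ S ⊆ φ.ker ∧
      ∃ C : ℕ, ∀ h ∈ φ.ker, ∀ l, WordLe T h l → WordLe S h ((C * (l + 2)) ^ 2) := by
  obtain ⟨r, q, χ, hχ, hχ', hfin⟩ := exists_independent_finiteIndex_closure Q
  choose m hm hmA using fun i => hA (q i)
  choose n hn hnB using fun i => hB (q i)
  let N := ∏ i, m i * n i
  have hN : 0 < N := Finset.prod_pos fun i _ => Nat.mul_pos (hm i) (hn i)
  have hdvd : ∀ i, m i * n i ∣ N := fun i => Finset.dvd_prod_of_mem _ (Finset.mem_univ i)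
  have hNA : ∀ i, q i ^ N ∈ A.map φ := fun i => by
    obtain ⟨k, hk⟩ := (Dvd.intro _ rfl).trans (hdvd i)
    rw [hk, pow_mul]
    exact Subgroup.pow_mem _ (hmA i) k
  have hNB : ∀ i, q i ^ N ∈ B.map φ := fun i => by
    obtain ⟨k, hk⟩ := (Dvd.intro_left _ rfl).trans (hdvd i)
    rw [hk, pow_mul]
    exact Subgroup.pow_mem _ (hnB i) k
  choose a haA ha using hNA
  choose b hbB hb using hNB
  have := hfin N hN
  let K := (Subgroup.closure (Set.range fun i => q i ^ N)).comap φ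
  have : K.FiniteIndex := ⟨by
    rw [Subgroup.index_comap]
    exact Subgroup.FiniteIndex.index_ne_zero⟩
  have hK : K ≤ Subgroup.closure (Set.range b) ⊔ φ.ker := by
    rw [← Subgroup.comap_map_eq, MonoidHom.map_closure, ← Set.range_comp]
    exact Subgroup.comap_mono (Subgroup.closure_mono (by simp [Function.comp_def, hb]))
  obtain ⟨T', hT', hTT'⟩ := exists_schreier_generators K hT
  obtain ⟨S, hS, hSM, C, hC⟩ := exists_wordLe_sq_of_lifts φ.ker A b (fun i => b i * (a i)⁻¹)
    (fun i => by simp [MonoidHom.mem_ker, ha, hb]) (fun i => by simpa using haA i)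
    (fun i x hx => hAB x hx _ (hbB i)) (fun i => (χ i).comp φ)
    (fun i x hx => by simp [MonoidHom.mem_ker, MonoidHom.mem_ker.1 hx])
    (fun i => by simp [hb, hχ, hN]) (fun i j hij => by simp [hb, hχ' i j hij])
    (hT'.image K.subtype) (by rintro _ ⟨t, -, rfl⟩; exact hK t.2)
  refine ⟨S, hS, hSM, C, fun h hh l hl => hC h hh _ ?_⟩
  have hhK : h ∈ K := by
    rw [Subgroup.mem_comap, MonoidHom.mem_ker.1 hh]
    exact one_mem _
  simpa using (hTT' ⟨h, hhK⟩ l hl).map (S' := K.subtype '' T') (c := 1) K.subtype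
    fun s hs => .of_mem ⟨s, hs, rfl⟩

/-- Some power of each element of a finite-index normal subgroup `K` lies in `(R ⊓ K) * H` when
`R ⊔ H` has finite index. -/
theorem exists_pow_mem_of_finiteIndex_sup {G : Type*} [Group G] (R H K : Subgroup G) [R.Normal]
    [K.Normal] [K.FiniteIndex] (hRH : (R ⊔ H).FiniteIndex) {g : G} (hg : g ∈ K) :
    ∃ n, 0 < n ∧ ∃ a ∈ R ⊓ K, a⁻¹ * g ^ n ∈ H := by
  obtain ⟨k, hk, -, hgk⟩ := Subgroup.exists_pow_mem_of_index_ne_zero hRH.index_ne_zero g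
  obtain ⟨x, hx, h, hh, hxh⟩ := Subgroup.mem_sup_of_normal_left.1 hgk
  have hp : 0 < K.index := Nat.pos_of_ne_zero Subgroup.FiniteIndex.index_ne_zero
  have hhp : h ^ K.index ∈ K := K.pow_index_mem h
  refine ⟨k * K.index, Nat.mul_pos hk hp, g ^ (k * K.index) * (h ^ K.index)⁻¹, ⟨?_, ?_⟩, ?_⟩
  · change _ ∈ R
    rw [← QuotientGroup.eq_one_iff, pow_mul, ← hxh]
    simp [(QuotientGroup.eq_one_iff x).2 hx]
  · exact K.mul_mem (pow_mem hg _) (inv_mem hhp)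
  · simpa using pow_mem hh _

/-- A subgroup containing the commutators of a finite-index subgroup is at most quadratically
distorted if it spans a finite-index subgroup with each of two commuting normal subgroups. -/
theorem exists_wordLe_sq_of_commuting {G : Type*} [Group G] [Group.FG G]
    (A B H D' : Subgroup G) [A.Normal] [B.Normal] (hAB : ∀ a ∈ A, ∀ b ∈ B, Commute a b)
    (hA : (A ⊔ H).FiniteIndex) (hB : (B ⊔ H).FiniteIndex) [D'.FiniteIndex]
    (hcoab : ⁅D', D'⁆ ≤ H) {T : Set G} (hT : T.Finite) (hTG : Subgroup.closure T = ⊤) :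
    ∃ S : Set G, S.Finite ∧ S ⊆ H ∧
      ∃ C : ℕ, ∀ h ∈ H, ∀ l, WordLe T h l → WordLe S h ((C * (l + 1)) ^ 2) := by
  let K := D'.normalCore
  let M := H.subgroupOf K
  have hcomm : ∀ x y : K, x * y * x⁻¹ * y⁻¹ ∈ M := fun x y => hcoab <|
    Subgroup.commutator_mem_commutator (D'.normalCore_le x.2) (D'.normalCore_le y.2)
  have : M.Normal := ⟨fun m hm x => by
    have := M.mul_mem (hcomm x m) hm
    rwa [inv_mul_cancel_right] at this⟩
  let _ : CommGroup (K ⧸ M) :=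
    { mul_comm := fun x y => by
        obtain ⟨x, rfl⟩ := QuotientGroup.mk_surjective x
        obtain ⟨y, rfl⟩ := QuotientGroup.mk_surjective y
        rw [← QuotientGroup.mk_mul, ← QuotientGroup.mk_mul, QuotientGroup.eq]
        simpa [mul_assoc] using hcomm y⁻¹ x⁻¹ }
  have hpow : ∀ R : Subgroup G, R.Normal → (R ⊔ H).FiniteIndex → ∀ q : K ⧸ M,
      ∃ n, 0 < n ∧ q ^ n ∈ (R.subgroupOf K).map (QuotientGroup.mk' M) := by
    intro R _ hR q
    obtain ⟨g, rfl⟩ := QuotientGroup.mk_surjective q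
    obtain ⟨n, hn, a, ha, h⟩ := exists_pow_mem_of_finiteIndex_sup R H K hR g.2
    exact ⟨n, hn, ⟨a, ha.2⟩, ha.1, QuotientGroup.eq.2 h⟩
  obtain ⟨T', hT', hTT'⟩ := exists_schreier_generators K hT
  obtain ⟨S, hS, hSM, C, hC⟩ := exists_wordLe_sq_ker (QuotientGroup.mk' M)
    (A.subgroupOf K) (B.subgroupOf K)
    (fun a ha b hb => Subtype.ext (hAB _ ha _ hb)) (hpow A ‹_› hA) (hpow B ‹_› hB) hT'
  rw [QuotientGroup.ker_mk'] at hSM hC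
  have hrep : ∀ q : G ⧸ K, ∃ f ∈ H, ∀ h ∈ H, (h : G ⧸ K) = q → (f : G ⧸ K) = q := by
    intro q
    by_cases hq : ∃ h ∈ H, (h : G ⧸ K) = q
    · obtain ⟨h, hh, hq⟩ := hq
      exact ⟨h, hh, fun _ _ _ => hq⟩
    · exact ⟨1, H.one_mem, fun h hh hhq => (hq ⟨h, hh, hhq⟩).elim⟩
  choose f hfH hf using hrep
  obtain ⟨c, hc⟩ := (Set.finite_range f).exists_wordLe (S := T) fun g _ =>
    exists_wordLe_of_mem_closure (hTG ▸ Subgroup.mem_top g)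
  refine ⟨K.subtype '' S ∪ Set.range f, (hS.image _).union (Set.finite_range f), ?_,
    C * (c + 4) + 1, fun h hh l hl => ?_⟩
  · rintro _ (⟨s, hs, rfl⟩ | ⟨q, rfl⟩)
    exacts [hSM hs, hfH q]
  have hkK : h * (f h)⁻¹ ∈ K := by
    rw [← QuotientGroup.eq_one_iff, QuotientGroup.mk_mul, QuotientGroup.mk_inv, hf h h hh rfl,
      mul_inv_cancel]
  have hkT : WordLe T (h * (f h)⁻¹) (l + c) := hl.mul (hc _ ⟨h, rfl⟩).inv
  have hkS := (hC ⟨_, hkK⟩ (H.mul_mem hh (H.inv_mem (hfH h))) _ (hTT' ⟨_, hkK⟩ _ hkT)).map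
    (S' := K.subtype '' S ∪ Set.range f) (c := 1) K.subtype
    fun s hs => .of_mem (.inl ⟨s, hs, rfl⟩)
  have hfS : WordLe (K.subtype '' S ∪ Set.range f) (f h) 1 := .of_mem (.inr ⟨h, rfl⟩)
  have hhS := hkS.mul hfS
  rw [Subgroup.subtype_apply, inv_mul_cancel_right] at hhS
  refine hhS.mono ?_
  have h1 : C * (l + c + 2 + 2) ≤ C * (c + 4) * (l + 1) := by
    rw [mul_assoc]
    exact Nat.mul_le_mul_left C (by nlinarith [Nat.zero_le (c * l)])
  calc 1 * (C * (l + c + 2 + 2)) ^ 2 + 1 ≤ (C * (l + c + 2 + 2) + 1) ^ 2 := by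
        nlinarith [Nat.zero_le (C * (l + c + 2 + 2))]
    _ ≤ ((C * (c + 4) + 1) * (l + 1)) ^ 2 := Nat.pow_le_pow_left (by nlinarith) 2

theorem normal_range_mulSingle {ι : Type*} [DecidableEq ι] {Γ : ι → Type*} [∀ i, Group (Γ i)]
    (i : ι) : (MonoidHom.mulSingle Γ i).range.Normal := by
  refine ⟨?_⟩
  rintro _ ⟨x, rfl⟩ g
  refine ⟨g i * x * (g i)⁻¹, ?_⟩
  ext j
  obtain rfl | hj := eq_or_ne j i
  · simp
  · simp [Pi.mulSingle_eq_of_ne hj]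

end Distortion

/-- A virtually-full, virtually-coabelian subgroup of a direct product of `n ≥ 2` finitely
generated groups is finitely generated and has quadratically bounded distortion. -/
theorem virtuallyFull_virtuallyCoabelian_fg_and_distortion
    (n : ℕ) (hn : 2 ≤ n) (Γ : Fin n → Type) [∀ i, Group (Γ i)]
    (hfg : ∀ i, Group.FG (Γ i))
    (H : Subgroup (∀ i, Γ i))
    (hfull : ∀ i, ((MonoidHom.mulSingle Γ i).range ⊔ H).FiniteIndex)
    (hcoab : ∃ D' : Subgroup (∀ i, Γ i), D'.FiniteIndex ∧ ⁅D', D'⁆ ≤ H) :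
    Group.FG H ∧
      ∀ (T : Set (∀ i, Γ i)), T.Finite → Subgroup.closure T = ⊤ →
      ∀ (S : Set H), S.Finite → Subgroup.closure S = ⊤ →
        ∃ C : ℕ, ∀ (l : ℕ) (h : H),
          wordLength T (h : ∀ i, Γ i) ≤ l → wordLength S h ≤ C * l ^ 2 := by
  obtain ⟨D', hD', hcoab⟩ := hcoab
  have : ∀ i, (MonoidHom.mulSingle Γ i).range.Normal := normal_range_mulSingle
  have hquad : ∀ T : Set (∀ i, Γ i), T.Finite → Subgroup.closure T = ⊤ →
      ∃ S : Set (∀ i, Γ i), S.Finite ∧ S ⊆ H ∧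
        ∃ C : ℕ, ∀ h ∈ H, ∀ l, WordLe T h l → WordLe S h ((C * (l + 1)) ^ 2) := by
    intro T hT hTG
    have hij : (⟨0, by omega⟩ : Fin n) ≠ ⟨1, by omega⟩ := by simp
    refine exists_wordLe_sq_of_commuting _ _ H D' ?_ (hfull ⟨0, by omega⟩)
      (hfull ⟨1, by omega⟩) hcoab hT hTG
    rintro _ ⟨x, rfl⟩ _ ⟨y, rfl⟩
    exact Pi.mulSingle_commute hij x y
  constructor
  · obtain ⟨T, hTG, hT⟩ := Group.fg_iff.1 (inferInstance : Group.FG (∀ i, Γ i))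
    obtain ⟨S, hS, hSH, C, hC⟩ := hquad T hT hTG
    refine Group.fg_iff.2 ⟨(↑) ⁻¹' S, ?_, hS.preimage Subtype.val_injective.injOn⟩
    rw [Subgroup.eq_top_iff']
    intro h
    exact ((hC h h.2 _ (wordLe_wordLength hTG _)).restrict hSH).mem Subgroup.subset_closure
  · intro T hT hTG S hS hSG
    obtain ⟨S₀, hS₀, hSH, C, hC⟩ := hquad T hT hTG
    obtain ⟨e, he⟩ := (hS₀.preimage (f := ((↑) : H → ∀ i, Γ i))
      Subtype.val_injective.injOn).exists_wordLe (S := S) fun g _ =>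
        exists_wordLe_of_mem_closure (hSG ▸ Subgroup.mem_top g)
    refine ⟨e * (2 * C) ^ 2, fun l h hl => ?_⟩
    have hhT := (wordLe_wordLength hTG (h : ∀ i, Γ i)).mono hl
    rcases Nat.eq_zero_or_pos l with rfl | hl0
    · obtain ⟨w, hw, -, hwh⟩ := hhT
      have h1 : h = 1 := by
        ext1
        rw [← hwh, List.length_eq_zero_iff.1 (Nat.le_zero.1 hw)]
        rfl
      exact h1 ▸ (WordLe.one S _).wordLength_le
    · refine (((hC h h.2 l hhT).restrict hSH).map (MonoidHom.id H) he).wordLength_le.trans ?_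
      rw [mul_assoc, ← mul_pow]
      refine Nat.mul_le_mul_left e (Nat.pow_le_pow_left ?_ 2)
      nlinarith [Nat.zero_le C]
end
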